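/- Uniqueness: Suppose a Hamiltonian H : [0,T] × C × ℝⁿ → ℝ satisfies conditions (A.1)–(A.5) and σ : C → ℝ satisfies (A.6). Then there exists at most one minimax solution φ of the Cauchy problem ∂ₜφ + H(t,x(·),∇φ) = 0 on [0,T) × C with boundary condition φ(T,x(·)) = σ(x(·)): any two minimax solutions coincide on [0,T] × C. -/

import Mathlib

open MeasureTheory Set Filter Topology

noncomputable section

attribute [local instance] Classical.propDecidable

/-- Euclidean space `ℝⁿ`. -/
abbrev Euc (n : ℕ) : Type := EuclideanSpace ℝ (Fin n)

/-- The path space `C([-h,T], ℝⁿ)` with the sup norm. -/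
abbrev PathSp (n : ℕ) (h T : ℝ) : Type := ContinuousMap (Set.Icc (-h) T) (Euc n)

/-- The time map `τ ↦ τ ∧ t` on `[-h,T]` (for `t ∈ [0,T]`, `h ≥ 0`, this is `min τ t`). -/
def stopTime (h T t : ℝ) (τ : Set.Icc (-h) T) : Set.Icc (-h) T :=
  ⟨max (-h) (min τ.1 t), le_max_left _ _,
    max_le (le_trans τ.2.1 τ.2.2) (le_trans (min_le_left _ _) τ.2.2)⟩

lemma continuous_stopTime (h T t : ℝ) : Continuous (stopTime h T t) :=
  Continuous.subtype_mk
    (continuous_const.max (continuous_subtype_val.min continuous_const)) _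

/-- The stopped path `x(· ∧ t)`. -/
def stopPath {n : ℕ} {h T : ℝ} (t : ℝ) (x : PathSp n h T) : PathSp n h T :=
  x.comp ⟨stopTime h T t, continuous_stopTime h T t⟩

/-- Evaluation of a path at a real time (times outside `[-h,T]` are projected). -/
def evalP {n : ℕ} {h T : ℝ} (x : PathSp n h T) (τ : ℝ) : Euc n :=
  if hc : -h ≤ T then x (Set.projIcc (-h) T hc τ) else 0

/-- The `L¹([0,T])` distance between two functions. -/
def L1dist (T : ℝ) (c₁ c₂ : ℝ → ℝ) : ℝ := ∫ τ in Set.Icc (0:ℝ) T, |c₁ τ - c₂ τ|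

/-- A nonnegative function in `L¹([0,T],ℝ)`. -/
def IntegNonneg (T : ℝ) (c : ℝ → ℝ) : Prop :=
  IntegrableOn c (Set.Icc 0 T) volume ∧ ∀ τ ∈ Set.Icc (0:ℝ) T, 0 ≤ c τ

/-- `AC(t,x(·))`, presented with an explicit derivative witness: pairs `(y, y')`
such that `y(·∧t) = x(·∧t)`, `y'` is integrable on `[t,T]`, and `y` is the
indefinite integral of `y'` on `[t,T]` (i.e. `y|_{[t,T]}` is absolutely continuous
with a.e. derivative `y'`). -/
def ACPair {n : ℕ} {h T : ℝ} (t : ℝ) (x : PathSp n h T) :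
    Set (PathSp n h T × (ℝ → Euc n)) :=
  {p | stopPath t p.1 = stopPath t x ∧ IntervalIntegrable p.2 volume t T ∧
       ∀ τ ∈ Set.Icc t T, evalP p.1 τ = evalP p.1 t + ∫ ξ in t..τ, p.2 ξ}

/-- The set `AC(t,x(·))`. -/
def ACSet {n : ℕ} {h T : ℝ} (t : ℝ) (x : PathSp n h T) : Set (PathSp n h T) :=
  {y | ∃ y', (y, y') ∈ ACPair t x}

/-- Pairs `(y, y')` with `y ∈ Y(t,x(·);c(·))` and derivative witness `y'`. -/
def YPair {n : ℕ} {h T : ℝ} (t : ℝ) (x : PathSp n h T) (c : ℝ → ℝ) :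
    Set (PathSp n h T × (ℝ → Euc n)) :=
  {p | p ∈ ACPair t x ∧
       ∀ᵐ τ ∂(volume.restrict (Set.Icc t T)), ‖p.2 τ‖ ≤ c τ * (1 + ‖stopPath τ p.1‖)}

/-- The set `Y(t,x(·);c(·))`. -/
def YSet {n : ℕ} {h T : ℝ} (t : ℝ) (x : PathSp n h T) (c : ℝ → ℝ) :
    Set (PathSp n h T) :=
  {y | ∃ y', (y, y') ∈ YPair t x c}

/-- Condition (A.1): measurability in `t` on `[0,T]`. -/
def CondA1 {n : ℕ} {h T : ℝ} (H : ℝ → PathSp n h T → Euc n → ℝ) : Prop :=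
  ∀ (x : PathSp n h T) (s : Euc n),
    Measurable ((Set.Icc (0:ℝ) T).restrict (fun t => H t x s))

/-- Condition (A.2): continuity in `(x,s)` for a.e. `t`. -/
def CondA2 {n : ℕ} {h T : ℝ} (H : ℝ → PathSp n h T → Euc n → ℝ) : Prop :=
  ∃ E : Set ℝ, E ⊆ Set.Icc 0 T ∧ volume E = ENNReal.ofReal T ∧
    ∀ t ∈ E, Continuous (fun p : PathSp n h T × Euc n => H t p.1 p.2)

/-- Condition (A.3) for a given compact set `D` and function `λ_H(·;D)`. -/
def CondA3For {n : ℕ} {h T : ℝ} (H : ℝ → PathSp n h T → Euc n → ℝ)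
    (D : Set (PathSp n h T)) (lam : ℝ → ℝ) : Prop :=
  IntegNonneg T lam ∧
  ∀ x₁ ∈ D, ∀ x₂ ∈ D, ∀ s : Euc n,
    ∃ E : Set ℝ, E ⊆ Set.Icc 0 T ∧ volume E = ENNReal.ofReal T ∧
      ∀ t ∈ E, |H t x₁ s - H t x₂ s| ≤
        lam t * (1 + ‖s‖) * ‖stopPath t x₁ - stopPath t x₂‖

/-- Condition (A.3). -/
def CondA3 {n : ℕ} {h T : ℝ} (H : ℝ → PathSp n h T → Euc n → ℝ) : Prop :=
  ∀ D : Set (PathSp n h T), IsCompact D → ∃ lam : ℝ → ℝ, CondA3For H D lam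

/-- Condition (A.4), with the function `c_H(·)` made explicit. -/
def CondA4 {n : ℕ} {h T : ℝ} (H : ℝ → PathSp n h T → Euc n → ℝ) (cH : ℝ → ℝ) : Prop :=
  IntegNonneg T cH ∧
  ∃ E : Set ℝ, E ⊆ Set.Icc 0 T ∧ volume E = ENNReal.ofReal T ∧
    ∀ t ∈ E, ∀ (x : PathSp n h T) (s₁ s₂ : Euc n),
      |H t x s₁ - H t x s₂| ≤ cH t * (1 + ‖stopPath t x‖) * ‖s₁ - s₂‖

/-- Condition (A.5) for a given compact set `D` and function `m_H(·;D)`. -/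
def CondA5For {n : ℕ} {h T : ℝ} (H : ℝ → PathSp n h T → Euc n → ℝ)
    (D : Set (PathSp n h T)) (m : ℝ → ℝ) : Prop :=
  IntegNonneg T m ∧
  ∀ x ∈ D, ∃ E : Set ℝ, E ⊆ Set.Icc 0 T ∧ volume E = ENNReal.ofReal T ∧
    ∀ t ∈ E, |H t x (0 : Euc n)| ≤ m t

/-- Condition (A.5). -/
def CondA5 {n : ℕ} {h T : ℝ} (H : ℝ → PathSp n h T → Euc n → ℝ) : Prop :=
  ∀ D : Set (PathSp n h T), IsCompact D → ∃ m : ℝ → ℝ, CondA5For H D m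

/-- Conditions (A.1)–(A.5), with the function `c_H(·)` from (A.4) made explicit. -/
def CondA {n : ℕ} {h T : ℝ} (H : ℝ → PathSp n h T → Euc n → ℝ) (cH : ℝ → ℝ) : Prop :=
  CondA1 H ∧ CondA2 H ∧ CondA3 H ∧ CondA4 H cH ∧ CondA5 H

/-- A functional `φ` on `[0,T] × C` is non-anticipative. -/
def NonAnticipative {n : ℕ} {h T : ℝ} (φ : ℝ → PathSp n h T → ℝ) : Prop :=
  ∀ t ∈ Set.Icc (0:ℝ) T, ∀ x : PathSp n h T, φ t x = φ t (stopPath t x)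

/-- Property (U) from the definition of an upper solution. -/
def PropU {n : ℕ} {h T : ℝ} (H : ℝ → PathSp n h T → Euc n → ℝ) (cH : ℝ → ℝ)
    (φ : ℝ → PathSp n h T → ℝ) : Prop :=
  ∀ t ∈ Set.Ico (0:ℝ) T, ∀ x : PathSp n h T, ∀ s : Euc n, ∀ τ ∈ Set.Ioc t T,
    ∃ p ∈ YPair t x cH,
      φ τ p.1 - ∫ ξ in t..τ, (@inner ℝ _ _ s (p.2 ξ) - H ξ p.1 s) ≤ φ t x

/-- Property (L) from the definition of a lower solution. -/
def PropL {n : ℕ} {h T : ℝ} (H : ℝ → PathSp n h T → Euc n → ℝ) (cH : ℝ → ℝ)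
    (φ : ℝ → PathSp n h T → ℝ) : Prop :=
  ∀ t ∈ Set.Ico (0:ℝ) T, ∀ x : PathSp n h T, ∀ s : Euc n, ∀ τ ∈ Set.Ioc t T,
    ∃ p ∈ YPair t x cH,
      φ t x ≤ φ τ p.1 - ∫ ξ in t..τ, (@inner ℝ _ _ s (p.2 ξ) - H ξ p.1 s)

/-- Upper solution of the Cauchy problem for `H` (with `c_H` from (A.4)) and `σ`. -/
def UpperSol {n : ℕ} {h T : ℝ} (H : ℝ → PathSp n h T → Euc n → ℝ) (cH : ℝ → ℝ)
    (σ : PathSp n h T → ℝ) (φ : ℝ → PathSp n h T → ℝ) : Prop :=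
  NonAnticipative φ ∧
  LowerSemicontinuousOn (fun p : ℝ × PathSp n h T => φ p.1 p.2)
    (Set.Icc 0 T ×ˢ (Set.univ : Set (PathSp n h T))) ∧
  (∀ x : PathSp n h T, σ x ≤ φ T x) ∧
  PropU H cH φ

/-- Lower solution of the Cauchy problem for `H` (with `c_H` from (A.4)) and `σ`. -/
def LowerSol {n : ℕ} {h T : ℝ} (H : ℝ → PathSp n h T → Euc n → ℝ) (cH : ℝ → ℝ)
    (σ : PathSp n h T → ℝ) (φ : ℝ → PathSp n h T → ℝ) : Prop :=
  NonAnticipative φ ∧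
  UpperSemicontinuousOn (fun p : ℝ × PathSp n h T => φ p.1 p.2)
    (Set.Icc 0 T ×ˢ (Set.univ : Set (PathSp n h T))) ∧
  (∀ x : PathSp n h T, φ T x ≤ σ x) ∧
  PropL H cH φ

/-- Minimax solution of the Cauchy problem. -/
def MinimaxSol {n : ℕ} {h T : ℝ} (H : ℝ → PathSp n h T → Euc n → ℝ) (cH : ℝ → ℝ)
    (σ : PathSp n h T → ℝ) (φ : ℝ → PathSp n h T → ℝ) : Prop :=
  UpperSol H cH σ φ ∧ LowerSol H cH σ φ

/-- `φ` is ci-differentiable at `(t,x(·))` with ci-derivatives `a = ∂ₜφ(t,x(·))`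
and `g = ∇φ(t,x(·))`. -/
def HasCiDeriv {n : ℕ} {h T : ℝ} (φ : ℝ → PathSp n h T → ℝ)
    (t : ℝ) (x : PathSp n h T) (a : ℝ) (g : Euc n) : Prop :=
  ∀ p ∈ ACPair t x, ∃ o : ℝ → ℝ,
    (∀ τ ∈ Set.Ioc t T,
      φ τ p.1 - φ t x =
        a * (τ - t) + @inner ℝ _ _ g (evalP p.1 τ - evalP x t) + o (τ - t)) ∧
    Tendsto (fun τ => o (τ - t) / (τ - t + ∫ ξ in t..τ, ‖p.2 ξ‖))
      (nhdsWithin t (Set.Ioi t)) (nhds 0)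

/-- `φ ∈ Φ`, with the ci-derivatives `Dt = ∂ₜφ`, `Dx = ∇φ` and the full-measure
set `Eφ` of ci-differentiability made explicit. -/
structure IsInPhi {n : ℕ} {h T : ℝ} (φ : ℝ → PathSp n h T → ℝ)
    (Dt : ℝ → PathSp n h T → ℝ) (Dx : ℝ → PathSp n h T → Euc n)
    (Eφ : Set ℝ) : Prop where
  cont : ContinuousOn (fun p : ℝ × PathSp n h T => φ p.1 p.2)
    (Set.Icc 0 T ×ˢ (Set.univ : Set (PathSp n h T)))
  absCont : ∀ t ∈ Set.Ico (0:ℝ) T, ∀ x : PathSp n h T, ∀ p ∈ ACPair t x,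
    ∀ θ ∈ Set.Ioo t T, ∃ g : ℝ → ℝ, IntervalIntegrable g volume t θ ∧
      ∀ τ ∈ Set.Icc t θ, φ τ p.1 = φ t p.1 + ∫ ξ in t..τ, g ξ
  Esub : Eφ ⊆ Set.Ico 0 T
  Efull : volume Eφ = ENNReal.ofReal T
  ciDiff : ∀ t ∈ Eφ, ∀ x : PathSp n h T, HasCiDeriv φ t x (Dt t x) (Dx t x)
  measD : ∀ x : PathSp n h T, Measurable (Eφ.restrict (fun t => (Dt t x, Dx t x)))
  contD : ∀ t ∈ Eφ, Continuous (fun x : PathSp n h T => (Dt t x, Dx t x))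
  bddD : ∀ D : Set (PathSp n h T), IsCompact D → ∀ θ ∈ Set.Ico (0:ℝ) T,
    ∃ m : ℝ → ℝ, (IntegrableOn m (Set.Icc 0 θ) volume ∧ ∀ τ ∈ Set.Icc (0:ℝ) θ, 0 ≤ m τ) ∧
      ∃ ℓ : ℝ, 0 < ℓ ∧ ∀ t ∈ Eφ ∩ Set.Icc 0 θ, ∀ x ∈ D, |Dt t x| ≤ m t ∧ ‖Dx t x‖ ≤ ℓ

/-- Semiclassical solution of the Cauchy problem (with derivative data). -/
def SemiclassicalSol {n : ℕ} {h T : ℝ} (H : ℝ → PathSp n h T → Euc n → ℝ)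
    (σ : PathSp n h T → ℝ) (φ : ℝ → PathSp n h T → ℝ)
    (Dt : ℝ → PathSp n h T → ℝ) (Dx : ℝ → PathSp n h T → Euc n) (Eφ : Set ℝ) : Prop :=
  IsInPhi φ Dt Dx Eφ ∧
  (∀ t ∈ Eφ, ∀ x : PathSp n h T, Dt t x + H t x (Dx t x) = 0) ∧
  ∀ x : PathSp n h T, φ T x = σ x

/-- The Steklov transform of `H` with respect to the first (time) variable,
with `H` extended by `0` outside `[0,T]`. -/
def steklov {n : ℕ} {h T : ℝ} (H : ℝ → PathSp n h T → Euc n → ℝ) (k : ℕ)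
    (t : ℝ) (x : PathSp n h T) (s : Euc n) : ℝ :=
  ((k : ℝ) / 2) * ∫ τ in (t - (k : ℝ)⁻¹)..(t + (k : ℝ)⁻¹),
    (if τ ∈ Set.Icc (0:ℝ) T then H τ (stopPath t x) s else 0)

/-! ### Differential game definitions -/

/-- Admissible controls with values in `P`. -/
def Ctrl {m : ℕ} (P : Set (Euc m)) : Set (ℝ → Euc m) :=
  {u | Measurable u ∧ ∀ τ, u τ ∈ P}

/-- Non-anticipative strategies mapping `Q`-valued controls to `P`-valued controls
on the interval `[t,T]`. -/
def NAStrat {mP mQ : ℕ} (P : Set (Euc mP)) (Q : Set (Euc mQ)) (t T : ℝ) :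
    Set ((ℝ → Euc mQ) → ℝ → Euc mP) :=
  {α | (∀ v ∈ Ctrl Q, α v ∈ Ctrl P) ∧
    ∀ τ ∈ Set.Icc t T, ∀ v ∈ Ctrl Q, ∀ v' ∈ Ctrl Q,
      (∀ᵐ ξ ∂(volume.restrict (Set.Icc t τ)), v ξ = v' ξ) →
      (∀ᵐ ξ ∂(volume.restrict (Set.Icc t τ)), α v ξ = α v' ξ)}

/-- `(y, y')` is (the derivative-witnessed) motion of the time-delay system
generated by `f` from `(t,x(·))` under controls `u(·)`, `v(·)`. -/
def IsMotion {n : ℕ} {h T : ℝ} {mP mQ : ℕ}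
    (f : ℝ → PathSp n h T → Euc mP → Euc mQ → Euc n)
    (t : ℝ) (x : PathSp n h T) (u : ℝ → Euc mP) (v : ℝ → Euc mQ)
    (p : PathSp n h T × (ℝ → Euc n)) : Prop :=
  p ∈ ACPair t x ∧
  ∀ᵐ τ ∂(volume.restrict (Set.Icc t T)), p.2 τ = f τ p.1 (u τ) (v τ)

/-- The set of values of the cost functional along motions (a singleton when
the motion exists and is unique). -/
def costVals {n : ℕ} {h T : ℝ} {mP mQ : ℕ}
    (f : ℝ → PathSp n h T → Euc mP → Euc mQ → Euc n)
    (χ : ℝ → PathSp n h T → Euc mP → Euc mQ → ℝ) (σ : PathSp n h T → ℝ)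
    (t : ℝ) (x : PathSp n h T) (u : ℝ → Euc mP) (v : ℝ → Euc mQ) : Set ℝ :=
  {r | ∃ p : PathSp n h T × (ℝ → Euc n), IsMotion f t x u v p ∧
        r = σ p.1 - ∫ τ in t..T, χ τ p.1 (u τ) (v τ)}

/-- The lower value `ρ⁻(t,x(·))` of the differential game. -/
def lowerValue {n : ℕ} {h T : ℝ} {mP mQ : ℕ} (P : Set (Euc mP)) (Q : Set (Euc mQ))
    (f : ℝ → PathSp n h T → Euc mP → Euc mQ → Euc n)
    (χ : ℝ → PathSp n h T → Euc mP → Euc mQ → ℝ) (σ : PathSp n h T → ℝ)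
    (t : ℝ) (x : PathSp n h T) : ℝ :=
  sInf ((fun α => sSup (⋃ v ∈ Ctrl Q, costVals f χ σ t x (α v) v)) '' NAStrat P Q t T)

/-- The upper value `ρ⁺(t,x(·))` of the differential game. -/
def upperValue {n : ℕ} {h T : ℝ} {mP mQ : ℕ} (P : Set (Euc mP)) (Q : Set (Euc mQ))
    (f : ℝ → PathSp n h T → Euc mP → Euc mQ → Euc n)
    (χ : ℝ → PathSp n h T → Euc mP → Euc mQ → ℝ) (σ : PathSp n h T → ℝ)
    (t : ℝ) (x : PathSp n h T) : ℝ :=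
  sSup ((fun β => sInf (⋃ u ∈ Ctrl P, costVals f χ σ t x u (β u))) '' NAStrat Q P t T)

/-- The lower Hamiltonian `H⁻` (defined via the full-measure set `EC` from (C.2)). -/
def Hlow {n : ℕ} {h T : ℝ} {mP mQ : ℕ} (P : Set (Euc mP)) (Q : Set (Euc mQ))
    (f : ℝ → PathSp n h T → Euc mP → Euc mQ → Euc n)
    (χ : ℝ → PathSp n h T → Euc mP → Euc mQ → ℝ) (EC : Set ℝ)
    (τ : ℝ) (y : PathSp n h T) (s : Euc n) : ℝ :=
  if τ ∈ EC then
    sSup ((fun v => sInf ((fun u => @inner ℝ _ _ s (f τ y u v) - χ τ y u v) '' P)) '' Q)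
  else 0

/-- The upper Hamiltonian `H⁺` (defined via the full-measure set `EC` from (C.2)). -/
def Hup {n : ℕ} {h T : ℝ} {mP mQ : ℕ} (P : Set (Euc mP)) (Q : Set (Euc mQ))
    (f : ℝ → PathSp n h T → Euc mP → Euc mQ → Euc n)
    (χ : ℝ → PathSp n h T → Euc mP → Euc mQ → ℝ) (EC : Set ℝ)
    (τ : ℝ) (y : PathSp n h T) (s : Euc n) : ℝ :=
  if τ ∈ EC then
    sInf ((fun u => sSup ((fun v => @inner ℝ _ _ s (f τ y u v) - χ τ y u v) '' Q)) '' P)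
  else 0

/-- Assumption (C) on the data `(f, χ, σ)` of the differential game, with the
full-measure set `EC` from (C.2) and the function `c_f(·)` from (C.4) explicit. -/
structure AssumpC {n : ℕ} {h T : ℝ} {mP mQ : ℕ} (P : Set (Euc mP)) (Q : Set (Euc mQ))
    (f : ℝ → PathSp n h T → Euc mP → Euc mQ → Euc n)
    (χ : ℝ → PathSp n h T → Euc mP → Euc mQ → ℝ)
    (σ : PathSp n h T → ℝ) (EC : Set ℝ) (cf : ℝ → ℝ) : Prop where
  meas : ∀ (y : PathSp n h T) (u : Euc mP) (v : Euc mQ),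
    Measurable ((Set.Icc (0:ℝ) T).restrict (fun τ => (f τ y u v, χ τ y u v)))
  ECsub : EC ⊆ Set.Icc 0 T
  ECfull : volume EC = ENNReal.ofReal T
  contOn : ∀ τ ∈ EC, ContinuousOn
    (fun p : PathSp n h T × Euc mP × Euc mQ => (f τ p.1 p.2.1 p.2.2, χ τ p.1 p.2.1 p.2.2))
    ((Set.univ : Set (PathSp n h T)) ×ˢ P ×ˢ Q)
  lip : ∀ D : Set (PathSp n h T), IsCompact D → ∃ lam : ℝ → ℝ, IntegNonneg T lam ∧
    ∃ E : Set ℝ, E ⊆ Set.Icc 0 T ∧ volume E = ENNReal.ofReal T ∧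
      ∀ τ ∈ E, ∀ y₁ ∈ D, ∀ y₂ ∈ D, ∀ u ∈ P, ∀ v ∈ Q,
        ‖f τ y₁ u v - f τ y₂ u v‖ + |χ τ y₁ u v - χ τ y₂ u v| ≤
          lam τ * ‖stopPath τ y₁ - stopPath τ y₂‖
  growth : IntegNonneg T cf ∧
    ∃ E : Set ℝ, E ⊆ Set.Icc 0 T ∧ volume E = ENNReal.ofReal T ∧
      ∀ τ ∈ E, ∀ y : PathSp n h T, ∀ u ∈ P, ∀ v ∈ Q,
        ‖f τ y u v‖ ≤ cf τ * (1 + ‖stopPath τ y‖)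
  bdd : ∀ D : Set (PathSp n h T), IsCompact D → ∃ m : ℝ → ℝ, IntegNonneg T m ∧
    ∃ E : Set ℝ, E ⊆ Set.Icc 0 T ∧ volume E = ENNReal.ofReal T ∧
      ∀ τ ∈ E, ∀ y ∈ D, ∀ u ∈ P, ∀ v ∈ Q, |χ τ y u v| ≤ m τ
  sigC : Continuous σ


lemma evalP_eq {n : ℕ} {h T : ℝ} (x : PathSp n h T) {τ : ℝ} (hτ : τ ∈ Set.Icc (-h) T) :
    evalP x τ = x ⟨τ, hτ⟩ := by
  have hc : -h ≤ T := hτ.1.trans hτ.2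
  rw [evalP, dif_pos hc, Set.projIcc_of_mem hc hτ]

lemma evalP_stop {n : ℕ} {h T : ℝ} (x : PathSp n h T) {t τ : ℝ} (hτ : τ ∈ Set.Icc (-h) T)
    (ht : -h ≤ t) : evalP (stopPath t x) τ = evalP x (min τ t) := by
  have hm : min τ t ∈ Set.Icc (-h) T := ⟨le_min hτ.1 ht, (min_le_left _ _).trans hτ.2⟩
  rw [evalP_eq _ hτ, evalP_eq _ hm]
  simp only [stopPath, ContinuousMap.comp_apply, ContinuousMap.coe_mk]
  congr 1
  exact Subtype.ext (max_eq_right hm.1)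

lemma evalP_sub {n : ℕ} {h T : ℝ} (x y : PathSp n h T) {τ : ℝ} (hτ : τ ∈ Set.Icc (-h) T) :
    evalP (x - y) τ = evalP x τ - evalP y τ := by
  rw [evalP_eq _ hτ, evalP_eq _ hτ, evalP_eq _ hτ]; rfl

lemma norm_evalP_le {n : ℕ} {h T : ℝ} (x : PathSp n h T) (τ : ℝ) : ‖evalP x τ‖ ≤ ‖x‖ := by
  unfold evalP
  split_ifs
  · exact x.norm_coe_le_norm _
  · simp

lemma path_norm_le {n : ℕ} {h T : ℝ} (x : PathSp n h T) {C : ℝ} (hC : 0 ≤ C)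
    (hx : ∀ τ ∈ Set.Icc (-h) T, ‖evalP x τ‖ ≤ C) : ‖x‖ ≤ C := by
  rw [ContinuousMap.norm_le _ hC]
  intro τ
  have := hx τ.1 τ.2
  rwa [evalP_eq _ τ.2] at this

lemma path_ext {n : ℕ} {h T : ℝ} {x y : PathSp n h T}
    (hx : ∀ τ ∈ Set.Icc (-h) T, evalP x τ = evalP y τ) : x = y := by
  ext1 τ
  have := hx τ.1 τ.2
  rwa [evalP_eq _ τ.2, evalP_eq _ τ.2] at this

lemma continuous_evalP {n : ℕ} {h T : ℝ} (x : PathSp n h T) : Continuous (evalP x) := by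
  by_cases hc : -h ≤ T
  · have : evalP x = fun τ => x (Set.projIcc (-h) T hc τ) := by
      funext τ; rw [evalP, dif_pos hc]
    rw [this]
    exact x.continuous.comp continuous_projIcc
  · have : evalP x = fun _ => 0 := by
      funext τ; rw [evalP, dif_neg hc]
    rw [this]; exact continuous_const

lemma stop_stop {n : ℕ} {h T : ℝ} (x : PathSp n h T) {a b : ℝ} (hab : a ≤ b) :
    stopPath a (stopPath b x) = stopPath a x := by
  ext1 τ
  simp only [stopPath, ContinuousMap.comp_apply, ContinuousMap.coe_mk]
  congr 1
  apply Subtype.ext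
  simp only [stopTime]
  grind

lemma stop_sub {n : ℕ} {h T : ℝ} (x y : PathSp n h T) (a : ℝ) :
    stopPath a (x - y) = stopPath a x - stopPath a y := rfl

lemma norm_stop_le {n : ℕ} {h T : ℝ} (x : PathSp n h T) (a : ℝ) : ‖stopPath a x‖ ≤ ‖x‖ := by
  rw [ContinuousMap.norm_le _ (norm_nonneg _)]
  intro τ
  exact x.norm_coe_le_norm _

lemma norm_stop_mono {n : ℕ} {h T : ℝ} (x : PathSp n h T) :
    Monotone (fun t => ‖stopPath t x‖) := by
  intro a b hab
  simp only
  rw [← stop_stop x hab]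
  exact norm_stop_le _ _

lemma ae_le_of_full {T : ℝ} {f g : ℝ → ℝ}
    (hf : AEMeasurable f (volume.restrict (Set.Icc 0 T)))
    (hg : AEMeasurable g (volume.restrict (Set.Icc 0 T)))
    {E : Set ℝ} (hE : E ⊆ Set.Icc 0 T) (hv : volume E = ENNReal.ofReal T)
    (hfg : ∀ t ∈ E, f t ≤ g t) :
    ∀ᵐ t ∂(volume.restrict (Set.Icc 0 T)), f t ≤ g t := by
  have hN : NullMeasurableSet {t | f t ≤ g t} (volume.restrict (Set.Icc 0 T)) :=
    nullMeasurableSet_le hf hg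
  have hc : (volume.restrict (Set.Icc 0 T)) {t | f t ≤ g t}ᶜ = 0 := by
    rw [measure_compl₀ hN (measure_ne_top _ _)]
    apply tsub_eq_zero_of_le
    calc (volume.restrict (Set.Icc 0 T)) Set.univ = ENNReal.ofReal T := by simp
      _ = volume E := hv.symm
      _ = (volume.restrict (Set.Icc 0 T)) E := (Measure.restrict_eq_self _ hE).symm
      _ ≤ _ := measure_mono hfg
  exact hc

lemma H_aemeas {n : ℕ} {h T : ℝ} {H : ℝ → PathSp n h T → Euc n → ℝ} (h1 : CondA1 H)
    (x : PathSp n h T) (s : Euc n) :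
    AEMeasurable (fun t => H t x s) (volume.restrict (Set.Icc 0 T)) :=
  aemeasurable_restrict_of_measurable_subtype measurableSet_Icc (h1 x s)

lemma H_lip {n : ℕ} {h T : ℝ} {H : ℝ → PathSp n h T → Euc n → ℝ} (h1 : CondA1 H)
    {D : Set (PathSp n h T)} {lam : ℝ → ℝ} (h3 : CondA3For H D lam)
    {x₁ x₂ : PathSp n h T} (hx₁ : x₁ ∈ D) (hx₂ : x₂ ∈ D) (s : Euc n) :
    ∀ᵐ t ∂(volume.restrict (Set.Icc 0 T)),
      |H t x₁ s - H t x₂ s| ≤ lam t * (1 + ‖s‖) * ‖stopPath t (x₁ - x₂)‖ := by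
  obtain ⟨E, hE, hv, hb⟩ := h3.2 x₁ hx₁ x₂ hx₂ s
  refine ae_le_of_full ?_ ?_ hE hv hb
  · exact ((H_aemeas h1 x₁ s).sub (H_aemeas h1 x₂ s)).abs
  · exact (h3.1.1.aemeasurable.mul_const _).mul (norm_stop_mono _).measurable.aemeasurable

lemma H_stop {n : ℕ} {h T : ℝ} {H : ℝ → PathSp n h T → Euc n → ℝ} (h1 : CondA1 H)
    (h3 : CondA3 H) (x : PathSp n h T) (b : ℝ) (s : Euc n) :
    ∀ᵐ t ∂(volume.restrict (Set.Icc 0 T)), t ≤ b → H t x s = H t (stopPath b x) s := by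
  obtain ⟨lam, hl⟩ := h3 {x, stopPath b x} (by simp)
  filter_upwards [H_lip h1 hl (x₁ := x) (x₂ := stopPath b x) (by simp) (by simp) s] with t ht htb
  rw [stop_sub, stop_stop x htb] at ht
  simp only [sub_self, norm_zero, mul_zero] at ht
  have := abs_nonneg (H t x s - H t (stopPath b x) s)
  exact sub_eq_zero.1 (abs_eq_zero.1 (le_antisymm ht this))

lemma H_integ {n : ℕ} {h T : ℝ} {H : ℝ → PathSp n h T → Euc n → ℝ} (h1 : CondA1 H)
    {cH : ℝ → ℝ} (h4 : CondA4 H cH) (h5 : CondA5 H) (x : PathSp n h T) (s : Euc n) :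
    IntegrableOn (fun t => H t x s) (Set.Icc 0 T) := by
  obtain ⟨m, hm, hm'⟩ := h5 {x} isCompact_singleton
  obtain ⟨E, hE, hv, hb⟩ := hm' x rfl
  obtain ⟨hc, E', hE', hv', hb'⟩ := h4
  have a1 : ∀ᵐ t ∂(volume.restrict (Set.Icc 0 T)), |H t x 0| ≤ m t :=
    ae_le_of_full (H_aemeas h1 x 0).abs hm.1.aemeasurable hE hv hb
  have a2 : ∀ᵐ t ∂(volume.restrict (Set.Icc 0 T)),
      |H t x s - H t x 0| ≤ cH t * (1 + ‖stopPath t x‖) * ‖s - 0‖ :=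
    ae_le_of_full ((H_aemeas h1 x s).sub (H_aemeas h1 x 0)).abs
      ((hc.1.aemeasurable.mul
        (measurable_const.add (norm_stop_mono x).measurable).aemeasurable).mul_const _)
      hE' hv' (fun t ht => hb' t ht x s 0)
  have a3 : ∀ᵐ t ∂(volume.restrict (Set.Icc 0 T)), t ∈ Set.Icc 0 T :=
    ae_restrict_mem measurableSet_Icc
  refine Integrable.mono' (g := fun t => m t + cH t * ((1 + ‖x‖) * ‖s‖))
    (hm.1.add (hc.1.mul_const _)) (H_aemeas h1 x s).aestronglyMeasurable ?_
  filter_upwards [a1, a2, a3] with t b1 b2 b3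
  rw [sub_zero] at b2
  have c0 := hc.2 t b3
  have : cH t * (1 + ‖stopPath t x‖) * ‖s‖ ≤ cH t * ((1 + ‖x‖) * ‖s‖) := by
    rw [mul_assoc]
    have := norm_stop_le x t
    gcongr
  rw [Real.norm_eq_abs]
  have h6 := abs_add_le (H t x s - H t x 0) (H t x 0)
  rw [sub_add_cancel] at h6
  linarith

lemma V_step {F : Type*} [NormedAddCommGroup F] [InnerProductSpace ℝ F] (a b : F) {M M' r R : ℝ}
    (haM : ‖a‖ ≤ M) (hMM : M ≤ M') (hbM : ‖b‖ ≤ M') (hab : ‖b - a‖ ≤ r) (hR : M' ≤ R)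
    (hor : M' = M ∨ M' ≤ ‖a‖ + r) :
    (M' ^ 2 - ‖b‖ ^ 2) ^ 2 + ‖b‖ ^ 4 ≤ (M ^ 2 - ‖a‖ ^ 2) ^ 2 + ‖a‖ ^ 4 +
      inner ℝ ((4 * (2 * ‖a‖ ^ 2 - M ^ 2)) • a) (b - a) + 26 * R ^ 2 * r ^ 2 := by
  have ha0 := norm_nonneg a
  have hb0 := norm_nonneg b
  have hd0 := norm_nonneg (b - a)
  have hr0 : 0 ≤ r := hd0.trans hab
  have hM0 : 0 ≤ M := ha0.trans haM
  have hM'0 : 0 ≤ M' := hM0.trans hMM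
  have hR0 : 0 ≤ R := hM'0.trans hR
  have hq : ‖b‖ ^ 2 = ‖a‖ ^ 2 + 2 * inner ℝ a (b - a) + ‖b - a‖ ^ 2 := by
    have := norm_add_sq_real a (b - a)
    rwa [add_sub_cancel] at this
  rw [real_inner_smul_left]
  set i := inner ℝ a (b - a)
  set d := ‖b - a‖
  set A := ‖a‖
  set B := ‖b‖
  have hBA : |B - A| ≤ r := (abs_norm_sub_norm_le b a).trans hab
  have h1 := abs_le.1 hBA
  -- first part
  have p1 : (M' ^ 2 - M ^ 2) * (M' ^ 2 + M ^ 2 - 2 * B ^ 2) ≤ 16 * R ^ 2 * r ^ 2 := by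
    rcases hor with h | h
    · rw [h]; simp; positivity
    · have e1 : M' ^ 2 - M ^ 2 ≤ 2 * R * r := by
        have : (M' - M) * (M' + M) ≤ r * (2 * R) :=
          mul_le_mul (by linarith) (by linarith) (by linarith) hr0
        nlinarith
      have e0 : 0 ≤ M' ^ 2 - M ^ 2 := by nlinarith
      have e2 : M' ^ 2 + M ^ 2 - 2 * B ^ 2 ≤ 8 * R * r := by
        have : (M' - B) * (M' + B) ≤ (2 * r) * (2 * R) :=
          mul_le_mul (by linarith) (by linarith) (by linarith) (by linarith)
        nlinarith
      calc _ ≤ (M' ^ 2 - M ^ 2) * (8 * R * r) := mul_le_mul_of_nonneg_left e2 e0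
        _ ≤ (2 * R * r) * (8 * R * r) := mul_le_mul_of_nonneg_right e1 (by positivity)
        _ = _ := by ring
  have p2 : (B ^ 2 - A ^ 2) ^ 2 ≤ 4 * R ^ 2 * r ^ 2 := by
    have : |B ^ 2 - A ^ 2| ≤ 2 * R * r := by
      have : B ^ 2 - A ^ 2 = (B - A) * (B + A) := by ring
      rw [this, abs_mul, abs_of_nonneg (by linarith : 0 ≤ B + A)]
      calc _ ≤ r * (2 * R) := mul_le_mul hBA (by linarith) (by linarith) hr0
        _ = _ := by ring
    have h2 := sq_le_sq' (by linarith [abs_le.1 this]) (abs_le.1 this).2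
    nlinarith
  have p3 : d ^ 2 * (4 * A ^ 2 - 2 * M ^ 2) ≤ 2 * R ^ 2 * r ^ 2 := by
    have e1 : 4 * A ^ 2 - 2 * M ^ 2 ≤ 2 * R ^ 2 := by
      nlinarith
    have e2 : d ^ 2 ≤ r ^ 2 := by gcongr
    calc _ ≤ d ^ 2 * (2 * R ^ 2) := mul_le_mul_of_nonneg_left e1 (by positivity)
      _ ≤ r ^ 2 * (2 * R ^ 2) := mul_le_mul_of_nonneg_right e2 (by positivity)
      _ = _ := by ring
  have key : (M' ^ 2 - B ^ 2) ^ 2 + B ^ 4 - ((M ^ 2 - A ^ 2) ^ 2 + A ^ 4) =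
      (M' ^ 2 - M ^ 2) * (M' ^ 2 + M ^ 2 - 2 * B ^ 2) + (B ^ 2 - A ^ 2) * (4 * A ^ 2 - 2 * M ^ 2)
        + 2 * (B ^ 2 - A ^ 2) ^ 2 := by ring
  have key2 : (B ^ 2 - A ^ 2) * (4 * A ^ 2 - 2 * M ^ 2) =
     4 * (2 * A ^ 2 - M ^ 2) * i + d ^ 2 * (4 * A ^ 2 - 2 * M ^ 2) := by
    rw [hq]; ring
  linarith

lemma ii_of_on {T a b : ℝ} {c : ℝ → ℝ} (hc : IntegrableOn c (Set.Icc 0 T))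
    (ha : a ∈ Set.Icc 0 T) (hb : b ∈ Set.Icc 0 T) : IntervalIntegrable c volume a b :=
  (hc.mono_set (Set.uIcc_subset_Icc ha hb)).intervalIntegrable

lemma ae_sub {T a b : ℝ} {P : ℝ → Prop} (ha : 0 ≤ a) (hb : b ≤ T)
    (hP : ∀ᵐ t ∂(volume.restrict (Set.Icc 0 T)), P t) :
    ∀ᵐ t ∂(volume.restrict (Set.Icc a b)), P t :=
  ae_mono (Measure.restrict_mono (Set.Icc_subset_Icc ha hb) le_rfl) hP

lemma step_path {n : ℕ} {h T : ℝ} (hh : 0 ≤ h) {c : ℝ → ℝ} (hc : IntegNonneg T c)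
    {t t' : ℝ} (ht : 0 ≤ t) (htt : t ≤ t') (htT : t' ≤ T) {y : PathSp n h T}
    (hy : stopPath t y = y) {p : PathSp n h T × (ℝ → Euc n)} (hp : p ∈ YPair t y c)
    (hΔ : ∫ ξ in t..t', c ξ ≤ 1 / 2) :
    (∀ τ ∈ Set.Icc (-h) t, evalP (stopPath t' p.1) τ = evalP y τ) ∧
    (1 + ‖stopPath t' p.1‖ ≤ (1 + ‖y‖) * Real.exp (2 * ∫ ξ in t..t', c ξ)) ∧
    (∀ a b, t ≤ a → a ≤ b → b ≤ t' →
      ‖evalP (stopPath t' p.1) b - evalP (stopPath t' p.1) a‖ ≤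
        (1 + ‖stopPath t' p.1‖) * ∫ ξ in a..b, c ξ) ∧
    (∫ ξ in t..t', p.2 ξ = evalP (stopPath t' p.1) T - evalP y T) := by
  obtain ⟨⟨hst, hIvl, hev⟩, hbd⟩ := hp
  have hT : 0 ≤ T := by linarith
  have q1 : ∀ τ ∈ Set.Icc (-h) t, evalP (stopPath t' p.1) τ = evalP y τ := by
    intro τ hτ
    have hτ' : τ ∈ Set.Icc (-h) T := ⟨hτ.1, by linarith [hτ.2]⟩
    rw [evalP_stop _ hτ' (by linarith), min_eq_left (by linarith [hτ.2])]
    have e1 := evalP_stop p.1 (t := t) hτ' (by linarith)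
    have e2 := evalP_stop y (t := t) hτ' (by linarith)
    rw [min_eq_left hτ.2] at e1 e2
    rw [← e1, ← e2, hst]
  have q2 : ∀ τ ∈ Set.Icc (-h) t', evalP (stopPath t' p.1) τ = evalP p.1 τ := by
    intro τ hτ
    rw [evalP_stop _ ⟨hτ.1, by linarith [hτ.2]⟩ (by linarith), min_eq_left hτ.2]
  have q3 : ∀ a b, t ≤ a → a ≤ b → b ≤ t' →
      ‖evalP (stopPath t' p.1) b - evalP (stopPath t' p.1) a‖ ≤
        (1 + ‖stopPath t' p.1‖) * ∫ ξ in a..b, c ξ := by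
    intro a b ha hab hb
    have ia : IntervalIntegrable p.2 volume t a :=
      hIvl.mono_set (by rw [Set.uIcc_of_le ha, Set.uIcc_of_le (by linarith)]
                        exact Set.Icc_subset_Icc le_rfl (by linarith))
    have ib : IntervalIntegrable p.2 volume t b :=
      hIvl.mono_set (by rw [Set.uIcc_of_le (by linarith), Set.uIcc_of_le (by linarith)]
                        exact Set.Icc_subset_Icc le_rfl (by linarith))
    rw [q2 b ⟨by linarith, hb⟩, q2 a ⟨by linarith, by linarith⟩,
      hev b ⟨by linarith, by linarith⟩, hev a ⟨ha, by linarith⟩, add_sub_add_left_eq_sub,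
      intervalIntegral.integral_interval_sub_left ib ia]
    rw [← intervalIntegral.integral_const_mul]
    apply intervalIntegral.norm_integral_le_of_norm_le hab
    · have h1 : ∀ᵐ τ ∂(volume.restrict (Set.Icc t T)), τ ∈ Set.Icc t T :=
        ae_restrict_mem measurableSet_Icc
      have h2 := hbd.and h1
      rw [ae_restrict_iff' measurableSet_Icc] at h2
      filter_upwards [h2] with τ hτ hτ2
      have hm : τ ∈ Set.Icc t T := ⟨by linarith [hτ2.1], by linarith [hτ2.2]⟩
      have c0 := hc.2 τ ⟨by linarith [hm.1], hm.2⟩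
      have m1 := norm_stop_mono p.1 (show τ ≤ t' by linarith [hτ2.2])
      simp only at m1
      calc _ ≤ c τ * (1 + ‖stopPath τ p.1‖) := (hτ hm).1
        _ ≤ c τ * (1 + ‖stopPath t' p.1‖) := by gcongr
        _ = _ := mul_comm _ _
    · exact (ii_of_on hc.1 ⟨by linarith, by linarith⟩ ⟨by linarith, by linarith⟩).const_mul _
  have Cmono : ∀ τ ∈ Set.Icc t t', 0 ≤ ∫ ξ in t..τ, c ξ ∧ ∫ ξ in t..τ, c ξ ≤ ∫ ξ in t..t', c ξ := by
    intro τ hτ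
    have e1 : 0 ≤ ∫ ξ in t..τ, c ξ := intervalIntegral.integral_nonneg hτ.1
      (fun u hu => hc.2 u ⟨by linarith [hu.1], by linarith [hu.2, hτ.2]⟩)
    have e2 : 0 ≤ ∫ ξ in τ..t', c ξ := intervalIntegral.integral_nonneg hτ.2
      (fun u hu => hc.2 u ⟨by linarith [hu.1, hτ.1], by linarith [hu.2]⟩)
    have e3 := intervalIntegral.integral_add_adjacent_intervals
      (ii_of_on hc.1 (a := t) (b := τ) ⟨by linarith, by linarith⟩ ⟨by linarith [hτ.1], by linarith [hτ.2]⟩)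
      (ii_of_on hc.1 (a := τ) (b := t') ⟨by linarith [hτ.1], by linarith [hτ.2]⟩ ⟨by linarith, by linarith⟩)
    exact ⟨e1, by linarith⟩
  have hΔ0 := (Cmono t' ⟨htt, le_rfl⟩).1
  refine ⟨q1, ?_, q3, ?_⟩
  · set Δ := ∫ ξ in t..t', c ξ
    have hn : ‖stopPath t' p.1‖ ≤ ‖y‖ + (1 + ‖stopPath t' p.1‖) * Δ := by
      apply path_norm_le _ (by positivity)
      intro τ hτ
      by_cases hτt : τ ≤ t
      · rw [q1 τ ⟨hτ.1, hτt⟩]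
        have := norm_evalP_le y τ
        have : 0 ≤ (1 + ‖stopPath t' p.1‖) * Δ := by positivity
        linarith
      · push Not at hτt
        have e : evalP (stopPath t' p.1) τ = evalP (stopPath t' p.1) (min τ t') := by
          rw [evalP_stop _ hτ (by linarith), evalP_stop _ ⟨le_min hτ.1 (by linarith),
            (min_le_left _ _).trans hτ.2⟩ (by linarith)]
          simp
        rw [e]
        have hm1 : t ≤ min τ t' := le_min hτt.le htt
        have := q3 t (min τ t') le_rfl hm1 (min_le_right _ _)
        have h2 := (Cmono (min τ t') ⟨hm1, min_le_right _ _⟩).2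
        have h3 : (1 + ‖stopPath t' p.1‖) * ∫ ξ in t..(min τ t'), c ξ ≤
            (1 + ‖stopPath t' p.1‖) * Δ := by gcongr
        have h4 := norm_evalP_le y t
        rw [← q1 t ⟨by linarith, le_rfl⟩] at h4
        have h5 := norm_sub_norm_le (evalP (stopPath t' p.1) (min τ t')) (evalP (stopPath t' p.1) t)
        linarith
    have he : 1 + 2 * Δ ≤ Real.exp (2 * Δ) := by
      have := Real.add_one_le_exp (2 * Δ); linarith
    have hy0 := norm_nonneg y
    have hy1 := norm_nonneg (stopPath t' p.1)
    have k1 : (1 + ‖stopPath t' p.1‖) * (1 - Δ) ≤ 1 + ‖y‖ := by linarith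
    have k2 : 1 ≤ (1 - Δ) * (1 + 2 * Δ) := by nlinarith
    calc 1 + ‖stopPath t' p.1‖ ≤ (1 + ‖stopPath t' p.1‖) * ((1 - Δ) * (1 + 2 * Δ)) :=
          le_mul_of_one_le_right (by linarith) k2
      _ = ((1 + ‖stopPath t' p.1‖) * (1 - Δ)) * (1 + 2 * Δ) := by ring
      _ ≤ (1 + ‖y‖) * (1 + 2 * Δ) := mul_le_mul_of_nonneg_right k1 (by linarith)
      _ ≤ _ := by gcongr
  · have e1 := hev t' ⟨htt, htT⟩
    have e2 : evalP (stopPath t' p.1) T = evalP p.1 t' := by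
      rw [evalP_stop _ ⟨by linarith, le_rfl⟩ (by linarith), min_eq_right htT]
    have e3 : evalP y T = evalP p.1 t := by
      rw [← q2 t ⟨by linarith, htt⟩, q1 t ⟨by linarith, le_rfl⟩]
      conv_lhs => rw [← hy]
      rw [evalP_stop _ ⟨by linarith, le_rfl⟩ (by linarith), min_eq_right (by linarith)]
    rw [e2, e3, e1]; simp

/-- The compact set of paths used in the comparison argument. -/
def DPath {n : ℕ} {h T : ℝ} (t₀ : ℝ) (x₀ : PathSp n h T) (K : ℝ) (c : ℝ → ℝ) :
    Set (PathSp n h T) :=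
  {y | evalP y (-h) = evalP x₀ (-h) ∧ ∀ a ∈ Set.Icc (-h) T, ∀ b ∈ Set.Icc (-h) T,
    ‖evalP y b - evalP y a‖ ≤ ‖evalP x₀ (min b t₀) - evalP x₀ (min a t₀)‖ +
      K * |∫ ξ in (max a t₀)..(max b t₀), c ξ|}

lemma DPath_compact {n : ℕ} {h T : ℝ} (hh : 0 ≤ h) (hT : 0 < T) {t₀ : ℝ}
    (ht₀ : t₀ ∈ Set.Icc 0 T) (x₀ : PathSp n h T) (K : ℝ) {c : ℝ → ℝ} (hc : IntegNonneg T c) :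
    IsCompact (DPath t₀ x₀ K c) := by
  have hcI : ∀ a b : ℝ, a ∈ Set.Icc (-h) T → b ∈ Set.Icc (-h) T →
      IntervalIntegrable c volume (max a t₀) (max b t₀) := fun a b ha hb =>
    ii_of_on hc.1 ⟨ht₀.1.trans (le_max_right _ _), max_le ha.2 ht₀.2⟩
      ⟨ht₀.1.trans (le_max_right _ _), max_le hb.2 ht₀.2⟩
  -- continuity of the modulus
  have hmod : ∀ a : Set.Icc (-h) T, Continuous (fun b : Set.Icc (-h) T =>
      ‖evalP x₀ (min b.1 t₀) - evalP x₀ (min a.1 t₀)‖ +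
      K * |∫ ξ in (max a.1 t₀)..(max b.1 t₀), c ξ|) := by
    intro a
    have h1 : ContinuousOn (fun b => ∫ ξ in (max a.1 t₀)..b, c ξ) (Set.Icc 0 T) := by
      have := intervalIntegral.continuousOn_primitive_interval' (μ := volume) (f := c)
        (a := max a.1 t₀) (b₁ := 0) (b₂ := T)
        (ii_of_on hc.1 ⟨le_rfl, hT.le⟩ ⟨hT.le, le_rfl⟩)
        (by rw [Set.uIcc_of_le hT.le]
            exact ⟨ht₀.1.trans (le_max_right _ _), max_le a.2.2 ht₀.2⟩)
      rwa [Set.uIcc_of_le hT.le] at this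
    have h2 : Continuous (fun b : Set.Icc (-h) T => ∫ ξ in (max a.1 t₀)..(max b.1 t₀), c ξ) := by
      refine h1.comp_continuous (f := fun b : Set.Icc (-h) T => max b.1 t₀) (by fun_prop) ?_
      intro b
      exact ⟨ht₀.1.trans (le_max_right _ _), max_le b.2.2 ht₀.2⟩
    have h3 := continuous_evalP x₀
    fun_prop
  have hbd : ∀ b : Set.Icc (-h) T, ∃ R, ∀ y ∈ DPath t₀ x₀ K c, ‖y b‖ ≤ R := by
    intro b
    refine ⟨‖evalP x₀ (-h)‖ + (‖evalP x₀ (min b.1 t₀) - evalP x₀ (min (-h) t₀)‖ +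
      K * |∫ ξ in (max (-h) t₀)..(max b.1 t₀), c ξ|), fun y hy => ?_⟩
    have h1 := hy.2 (-h) ⟨le_rfl, by linarith⟩ b b.2
    rw [hy.1] at h1
    have h2 := norm_sub_norm_le (evalP y b) (evalP x₀ (-h))
    rw [evalP_eq y b.2] at h1 h2
    have : y ⟨b.1, b.2⟩ = y b := rfl
    rw [this] at h1 h2
    linarith
  choose R hR using hbd
  refine ArzelaAscoli.isCompact_of_equicontinuous _ ?_ ?_
  · let l : Set.Icc (-h) T := ⟨-h, le_rfl, by linarith⟩
    have himg : ContinuousMap.toFun '' (DPath t₀ x₀ K c) =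
        {f : Set.Icc (-h) T → Euc n | f l = evalP x₀ (-h)} ∩
        ⋂ a : Set.Icc (-h) T, ⋂ b : Set.Icc (-h) T, {f | ‖f b - f a‖ ≤
        ‖evalP x₀ (min b.1 t₀) - evalP x₀ (min a.1 t₀)‖ +
        K * |∫ ξ in (max a.1 t₀)..(max b.1 t₀), c ξ|} := by
      ext f
      constructor
      · rintro ⟨y, hy, rfl⟩
        refine ⟨?_, ?_⟩
        · have := hy.1
          rwa [evalP_eq y l.2] at this
        · refine Set.mem_iInter.2 fun a => Set.mem_iInter.2 fun b => ?_
          have := hy.2 a a.2 b b.2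
          rw [evalP_eq y a.2, evalP_eq y b.2] at this
          exact this
      · rintro ⟨h1, h2⟩
        have h2' : ∀ a b : Set.Icc (-h) T, ‖f b - f a‖ ≤
          ‖evalP x₀ (min b.1 t₀) - evalP x₀ (min a.1 t₀)‖ +
          K * |∫ ξ in (max a.1 t₀)..(max b.1 t₀), c ξ| := fun a b =>
            Set.mem_iInter.1 (Set.mem_iInter.1 h2 a) b
        have hf : Continuous f := by
          rw [continuous_iff_continuousAt]
          intro a
          rw [ContinuousAt, tendsto_iff_norm_sub_tendsto_zero]
          refine squeeze_zero (fun _ => norm_nonneg _) (fun b => h2' a b) ?_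
          have := (hmod a).tendsto a
          simpa using this
        refine ⟨⟨f, hf⟩, ⟨?_, ?_⟩, rfl⟩
        · rw [evalP_eq _ l.2]; exact h1
        · intro a ha b hb
          rw [evalP_eq _ ha, evalP_eq _ hb]
          exact h2' ⟨a, ha⟩ ⟨b, hb⟩
    refine IsCompact.of_isClosed_subset
      (isCompact_univ_pi (fun b : Set.Icc (-h) T => isCompact_closedBall (0 : Euc n) (R b))) ?_ ?_
    · rw [himg]
      refine IsClosed.inter (isClosed_eq (continuous_apply _) continuous_const) ?_
      refine isClosed_iInter fun a => isClosed_iInter fun b => isClosed_le ?_ continuous_const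
      exact ((continuous_apply b).sub (continuous_apply a)).norm
    · rintro _ ⟨y, hy, rfl⟩ b -
      rw [mem_closedBall_zero_iff]
      exact hR b y hy
  · intro a
    refine Metric.equicontinuousAt_of_continuity_modulus (fun b : Set.Icc (-h) T =>
      ‖evalP x₀ (min b.1 t₀) - evalP x₀ (min a.1 t₀)‖ +
      K * |∫ ξ in (max a.1 t₀)..(max b.1 t₀), c ξ|) ?_ _
      (Filter.Eventually.of_forall fun b y => ?_)
    · have := (hmod a).tendsto a
      simpa using this
    · have := y.2.2 a a.2 b b.2
      rw [evalP_eq _ a.2, evalP_eq _ b.2] at this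
      rw [dist_comm, dist_eq_norm]
      exact this

lemma DPath_start {n : ℕ} {h T : ℝ} (hh : 0 ≤ h) (hT : 0 < T) {t₀ : ℝ}
    (ht₀ : t₀ ∈ Set.Icc 0 T) (x₀ : PathSp n h T) {K : ℝ} (hK : 0 ≤ K) (c : ℝ → ℝ) :
    stopPath t₀ x₀ ∈ DPath t₀ x₀ K c := by
  have hh0 : -h ≤ t₀ := by linarith [ht₀.1]
  refine ⟨?_, ?_⟩
  · rw [evalP_stop _ ⟨le_rfl, by linarith⟩ hh0, min_eq_left hh0]
  · intro a ha b hb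
    rw [evalP_stop _ ha hh0, evalP_stop _ hb hh0]
    have : 0 ≤ K * |∫ ξ in (max a t₀)..(max b t₀), c ξ| := by positivity
    linarith

lemma DPath_step {n : ℕ} {h T : ℝ} (hh : 0 ≤ h) {t₀ : ℝ}
    (ht₀ : t₀ ∈ Set.Icc 0 T) (x₀ : PathSp n h T) {K : ℝ} (hK : 0 ≤ K) {c : ℝ → ℝ}
    (hc : IntegNonneg T c) {t t' : ℝ} (ht : t₀ ≤ t) (htt : t ≤ t') (htT : t' ≤ T)
    {y y' : PathSp n h T} (hy : y ∈ DPath t₀ x₀ K c) (hy' : stopPath t' y' = y')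
    (h1 : ∀ τ ∈ Set.Icc (-h) t, evalP y' τ = evalP y τ)
    (h2 : ∀ a b, t ≤ a → a ≤ b → b ≤ t' → ‖evalP y' b - evalP y' a‖ ≤ K * ∫ ξ in a..b, c ξ) :
    y' ∈ DPath t₀ x₀ K c := by
  have h0 := ht₀.1
  have h00 := ht₀.2
  have hnn : ∀ a b, 0 ≤ a → a ≤ b → b ≤ T → 0 ≤ ∫ ξ in a..b, c ξ := fun a b ha hab hb =>
    intervalIntegral.integral_nonneg hab (fun u hu => hc.2 u ⟨ha.trans hu.1, hu.2.trans hb⟩)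
  have hadd : ∀ a b d, 0 ≤ a → a ≤ b → b ≤ d → d ≤ T →
      ∫ ξ in a..d, c ξ = (∫ ξ in a..b, c ξ) + ∫ ξ in b..d, c ξ := fun a b d ha hab hbd hd =>
    (intervalIntegral.integral_add_adjacent_intervals
      (ii_of_on hc.1 ⟨ha, by linarith⟩ ⟨by linarith, by linarith⟩)
      (ii_of_on hc.1 ⟨by linarith, by linarith⟩ ⟨by linarith, by linarith⟩)).symm
  -- bound for `t ≤ a ≤ b ≤ T`
  have h3 : ∀ a b, t ≤ a → a ≤ b → b ≤ T → ‖evalP y' b - evalP y' a‖ ≤ K * ∫ ξ in a..b, c ξ := by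
    intro a b ha hab hb
    have e : ∀ τ, t ≤ τ → τ ≤ T → evalP y' τ = evalP y' (min τ t') := by
      intro τ h5 h6
      conv_lhs => rw [← hy']
      rw [evalP_stop _ ⟨by linarith, h6⟩ (by linarith)]
    rw [e b (by linarith) hb, e a ha (by linarith)]
    refine (h2 (min a t') (min b t') (le_min ha htt) (min_le_min hab le_rfl)
      (min_le_right _ _)).trans ?_
    apply mul_le_mul_of_nonneg_left _ hK
    rcases le_total a t' with h7 | h7
    · rw [min_eq_left h7]
      have h8 : a ≤ min b t' := le_min hab h7
      rw [hadd a (min b t') b (by linarith) h8 (min_le_left _ _) hb]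
      have := hnn (min b t') b (by linarith) (min_le_left _ _) hb
      linarith
    · rw [min_eq_right h7, min_eq_right (h7.trans hab), intervalIntegral.integral_same]
      exact hnn a b (by linarith) hab hb
  have key : ∀ a ∈ Set.Icc (-h) T, ∀ b ∈ Set.Icc (-h) T, a ≤ b →
      ‖evalP y' b - evalP y' a‖ ≤ ‖evalP x₀ (min b t₀) - evalP x₀ (min a t₀)‖ +
      K * |∫ ξ in (max a t₀)..(max b t₀), c ξ| := by
    intro a ha b hb hab
    rcases le_total b t with hbt | hbt
    · rw [h1 b ⟨hb.1, hbt⟩, h1 a ⟨ha.1, hab.trans hbt⟩]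
      exact hy.2 a ha b hb
    · have hb0 : max b t₀ = b := max_eq_left (ht.trans hbt)
      have hb1 : min b t₀ = t₀ := min_eq_right (ht.trans hbt)
      rcases le_total a t with hat | hat
      · have e1 := h3 t b le_rfl hbt hb.2
        have e2 := hy.2 a ha t ⟨by linarith, by linarith⟩
        rw [← h1 t ⟨by linarith, le_rfl⟩, ← h1 a ⟨ha.1, hat⟩, min_eq_right ht,
          max_eq_left ht] at e2
        have hm : max a t₀ ≤ t := max_le hat ht
        have hm0 : 0 ≤ max a t₀ := h0.trans (le_max_right _ _)
        rw [hb0, hb1, hadd (max a t₀) t b hm0 hm hbt hb.2]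
        have n1 := hnn (max a t₀) t hm0 hm (by linarith)
        have n2 := hnn t b (by linarith) hbt hb.2
        rw [abs_of_nonneg n1] at e2
        rw [abs_of_nonneg (add_nonneg n1 n2), mul_add]
        have := norm_sub_le_norm_sub_add_norm_sub (evalP y' b) (evalP y' t) (evalP y' a)
        linarith
      · have e1 := h3 a b hat hab hb.2
        rw [hb0, max_eq_left (ht.trans hat), abs_of_nonneg (hnn a b (by linarith) hab hb.2)]
        have := norm_nonneg (evalP x₀ (min b t₀) - evalP x₀ (min a t₀))
        linarith
  refine ⟨?_, ?_⟩
  · rw [h1 (-h) ⟨le_rfl, by linarith⟩]; exact hy.1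
  · intro a ha b hb
    rcases le_total a b with hab | hab
    · exact key a ha b hb hab
    · have := key b hb a ha hab
      rw [norm_sub_rev, norm_sub_rev (evalP x₀ (min b t₀)), intervalIntegral.integral_symm,
        abs_neg]
      exact this

lemma int_lip {n : ℕ} {h T : ℝ} {H : ℝ → PathSp n h T → Euc n → ℝ} {cH : ℝ → ℝ}
    (hA1 : CondA1 H) (hA4 : CondA4 H cH) (hA5 : CondA5 H) {D : Set (PathSp n h T)} {lam : ℝ → ℝ}
    (hlam : CondA3For H D lam) {y₁ y₂ : PathSp n h T} (hy₁ : y₁ ∈ D) (hy₂ : y₂ ∈ D) (s : Euc n)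
    {t t' : ℝ} (ht : 0 ≤ t) (htt : t ≤ t') (htT : t' ≤ T) :
    (∫ ξ in t..t', H ξ y₂ s) - (∫ ξ in t..t', H ξ y₁ s) ≤
      (∫ ξ in t..t', lam ξ) * (1 + ‖s‖) * ‖y₁ - y₂‖ := by
  have m1 : t ∈ Set.Icc 0 T := ⟨ht, by linarith⟩
  have m2 : t' ∈ Set.Icc 0 T := ⟨by linarith, htT⟩
  have i1 := ii_of_on (H_integ hA1 hA4 hA5 y₁ s) m1 m2
  have i2 := ii_of_on (H_integ hA1 hA4 hA5 y₂ s) m1 m2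
  have i3 := ii_of_on hlam.1.1 m1 m2
  rw [← intervalIntegral.integral_sub i2 i1, mul_assoc, ← intervalIntegral.integral_mul_const]
  refine intervalIntegral.integral_mono_ae_restrict htt (i2.sub i1) (i3.mul_const _) ?_
  have hmem : ∀ᵐ ξ ∂(volume.restrict (Set.Icc t t')), ξ ∈ Set.Icc t t' :=
    ae_restrict_mem measurableSet_Icc
  filter_upwards [ae_sub ht htT (H_lip hA1 hlam hy₁ hy₂ s), hmem] with ξ hξ hm
  have l0 := hlam.1.2 ξ ⟨by linarith [hm.1], by linarith [hm.2]⟩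
  have h1 := (abs_le.1 hξ).1
  have h2 : lam ξ * (1 + ‖s‖) * ‖stopPath ξ (y₁ - y₂)‖ ≤ lam ξ * ((1 + ‖s‖) * ‖y₁ - y₂‖) := by
    rw [mul_assoc]
    have := norm_stop_le (y₁ - y₂) ξ
    gcongr
  linarith

lemma int_split {n : ℕ} {h T : ℝ} (hh : 0 ≤ h) {H : ℝ → PathSp n h T → Euc n → ℝ} {cH : ℝ → ℝ}
    (hA1 : CondA1 H) (hA3 : CondA3 H) (hA4 : CondA4 H cH) (hA5 : CondA5 H)
    {t t' : ℝ} (ht : 0 ≤ t) (htt : t ≤ t') (htT : t' ≤ T) {y : PathSp n h T}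
    (hy : stopPath t y = y) {p : PathSp n h T × (ℝ → Euc n)} (hp : p ∈ YPair t y cH)
    (hΔ : ∫ ξ in t..t', cH ξ ≤ 1 / 2) (s : Euc n) :
    ∫ ξ in t..t', (@inner ℝ _ _ s (p.2 ξ) - H ξ p.1 s) =
      inner ℝ s (evalP (stopPath t' p.1) T - evalP y T) -
        ∫ ξ in t..t', H ξ (stopPath t' p.1) s := by
  have m1 : t ∈ Set.Icc 0 T := ⟨ht, by linarith⟩
  have m2 : t' ∈ Set.Icc 0 T := ⟨by linarith, htT⟩
  have i1 := ii_of_on (H_integ hA1 hA4 hA5 p.1 s) m1 m2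
  have i2 : IntervalIntegrable p.2 volume t t' :=
    hp.1.2.1.mono_set (by rw [Set.uIcc_of_le htt, Set.uIcc_of_le (by linarith)]
                          exact Set.Icc_subset_Icc le_rfl htT)
  have i3 : IntervalIntegrable (fun ξ => @inner ℝ _ _ s (p.2 ξ)) volume t t' :=
    ⟨i2.1.const_inner s, i2.2.const_inner s⟩
  rw [intervalIntegral.integral_sub i3 i1, ← (step_path hh hA4.1 ht htt htT hy hp hΔ).2.2.2]
  congr 1
  · rw [intervalIntegral.integral_of_le htt, intervalIntegral.integral_of_le htt]
    exact integral_inner i2.1 s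
  · apply intervalIntegral.integral_congr_ae
    have := ae_sub ht htT (H_stop hA1 hA3 p.1 t' s)
    rw [ae_restrict_iff' measurableSet_Icc] at this
    filter_upwards [this] with ξ hξ hm
    rw [Set.uIoc_of_le htt] at hm
    exact hξ ⟨hm.1.le, hm.2⟩ hm.2

lemma step_main {n : ℕ} {h T : ℝ} (hh : 0 ≤ h) {H : ℝ → PathSp n h T → Euc n → ℝ} {cH : ℝ → ℝ}
    (hA : CondA H cH) {φ₁ φ₂ : ℝ → PathSp n h T → ℝ} (hn1 : NonAnticipative φ₁)
    (hn2 : NonAnticipative φ₂) (hU : PropU H cH φ₁) (hL : PropL H cH φ₂)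
    {t₀ : ℝ} (ht₀ : t₀ ∈ Set.Icc 0 T) (x₀ : PathSp n h T) {K : ℝ} (hK : 0 ≤ K)
    {lam : ℝ → ℝ} (hlam : CondA3For H (DPath t₀ x₀ K cH) lam)
    {t t' : ℝ} (ht : t₀ ≤ t) (htt : t < t') (htT : t' ≤ T)
    (hΔ : ∫ ξ in t..t', cH ξ ≤ 1 / 2) {y₁ y₂ : PathSp n h T}
    (hy₁ : y₁ ∈ DPath t₀ x₀ K cH) (hy₂ : y₂ ∈ DPath t₀ x₀ K cH)
    (hs₁ : stopPath t y₁ = y₁) (hs₂ : stopPath t y₂ = y₂)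
    (hk₁ : (1 + ‖y₁‖) * Real.exp (2 * ∫ ξ in t..t', cH ξ) ≤ K)
    (hk₂ : (1 + ‖y₂‖) * Real.exp (2 * ∫ ξ in t..t', cH ξ) ≤ K) (s : Euc n) :
    ∃ y₁' ∈ DPath t₀ x₀ K cH, ∃ y₂' ∈ DPath t₀ x₀ K cH,
      stopPath t' y₁' = y₁' ∧ stopPath t' y₂' = y₂' ∧
      1 + ‖y₁'‖ ≤ (1 + ‖y₁‖) * Real.exp (2 * ∫ ξ in t..t', cH ξ) ∧
      1 + ‖y₂'‖ ≤ (1 + ‖y₂‖) * Real.exp (2 * ∫ ξ in t..t', cH ξ) ∧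
      ‖y₁ - y₂‖ ≤ ‖y₁' - y₂'‖ ∧
      ‖evalP (y₁' - y₂') T - evalP (y₁ - y₂) T‖ ≤ 2 * K * ∫ ξ in t..t', cH ξ ∧
      (‖y₁' - y₂'‖ = ‖y₁ - y₂‖ ∨
        ‖y₁' - y₂'‖ ≤ ‖evalP (y₁ - y₂) T‖ + 2 * K * ∫ ξ in t..t', cH ξ) ∧
      φ₁ t' y₁' - φ₂ t' y₂' ≤ φ₁ t y₁ - φ₂ t y₂ +
        inner ℝ s (evalP (y₁' - y₂') T - evalP (y₁ - y₂) T) +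
        (∫ ξ in t..t', lam ξ) * (1 + ‖s‖) * ‖y₁' - y₂'‖ := by
  obtain ⟨hA1, -, hA3, hA4, hA5⟩ := hA
  have h0 := ht₀.1
  have ht0 : 0 ≤ t := h0.trans ht
  have hT0 : 0 ≤ T := by linarith
  have mT : T ∈ Set.Icc (-h) T := ⟨by linarith, le_rfl⟩
  have mt' : t' ∈ Set.Icc 0 T := ⟨by linarith, htT⟩
  obtain ⟨p, hp, hpφ⟩ := hU t ⟨ht0, by linarith⟩ y₁ s t' ⟨htt, htT⟩
  obtain ⟨q, hq, hqφ⟩ := hL t ⟨ht0, by linarith⟩ y₂ s t' ⟨htt, htT⟩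
  rw [int_split hh hA1 hA3 hA4 hA5 ht0 htt.le htT hs₁ hp hΔ s, hn1 t' mt' p.1] at hpφ
  rw [int_split hh hA1 hA3 hA4 hA5 ht0 htt.le htT hs₂ hq hΔ s, hn2 t' mt' q.1] at hqφ
  obtain ⟨a1, a2, a3, -⟩ := step_path hh hA4.1 ht0 htt.le htT hs₁ hp hΔ
  obtain ⟨b1, b2, b3, -⟩ := step_path hh hA4.1 ht0 htt.le htT hs₂ hq hΔ
  have hs₁' : stopPath t' (stopPath t' p.1) = stopPath t' p.1 := stop_stop _ le_rfl
  have hs₂' : stopPath t' (stopPath t' q.1) = stopPath t' q.1 := stop_stop _ le_rfl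
  generalize stopPath t' p.1 = y₁' at *
  generalize stopPath t' q.1 = y₂' at *
  have hnn : ∀ a b, 0 ≤ a → a ≤ b → b ≤ T → 0 ≤ ∫ ξ in a..b, cH ξ := fun a b ha hab hb =>
    intervalIntegral.integral_nonneg hab (fun u hu => hA4.1.2 u ⟨ha.trans hu.1, hu.2.trans hb⟩)
  have a4 : ∀ a b, t ≤ a → a ≤ b → b ≤ t' → ‖evalP y₁' b - evalP y₁' a‖ ≤ K * ∫ ξ in a..b, cH ξ :=
    fun a b u v w => (a3 a b u v w).trans (mul_le_mul_of_nonneg_right (a2.trans hk₁)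
      (hnn a b (by linarith) v (by linarith)))
  have b4 : ∀ a b, t ≤ a → a ≤ b → b ≤ t' → ‖evalP y₂' b - evalP y₂' a‖ ≤ K * ∫ ξ in a..b, cH ξ :=
    fun a b u v w => (b3 a b u v w).trans (mul_le_mul_of_nonneg_right (b2.trans hk₂)
      (hnn a b (by linarith) v (by linarith)))
  have hD₁ := DPath_step hh ht₀ x₀ hK hA4.1 ht htt.le htT hy₁ hs₁' a1 a4
  have hD₂ := DPath_step hh ht₀ x₀ hK hA4.1 ht htt.le htT hy₂ hs₂' b1 b4
  have hlip := int_lip hA1 hA4 hA5 hlam hD₁ hD₂ s ht0 htt.le htT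
  have hw : stopPath t (y₁ - y₂) = y₁ - y₂ := by rw [stop_sub, hs₁, hs₂]
  have hw' : stopPath t' (y₁' - y₂') = y₁' - y₂' := by rw [stop_sub, hs₁', hs₂']
  have hww : ∀ τ ∈ Set.Icc (-h) t, evalP (y₁' - y₂') τ = evalP (y₁ - y₂) τ := by
    intro τ hτ
    have : τ ∈ Set.Icc (-h) T := ⟨hτ.1, by linarith [hτ.2]⟩
    rw [evalP_sub _ _ this, evalP_sub _ _ this, a1 τ hτ, b1 τ hτ]
  have hwT : ∀ τ, t ≤ τ → τ ≤ T → evalP (y₁ - y₂) τ = evalP (y₁ - y₂) t := by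
    intro τ h1 h2
    conv_lhs => rw [← hw]
    rw [evalP_stop _ ⟨by linarith, h2⟩ (by linarith), min_eq_right h1]
  have hinc : ∀ τ, t ≤ τ → τ ≤ T → ‖evalP (y₁' - y₂') τ - evalP (y₁ - y₂) T‖ ≤
      2 * K * ∫ ξ in t..t', cH ξ := by
    intro τ h1 h2
    have hm : t ≤ min τ t' := le_min h1 htt.le
    have hm' : min τ t' ≤ t' := min_le_right _ _
    have e1 : evalP (y₁' - y₂') τ = evalP (y₁' - y₂') (min τ t') := by
      conv_lhs => rw [← hw']
      rw [evalP_stop _ ⟨by linarith, h2⟩ (by linarith)]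
    rw [e1, hwT T (by linarith) le_rfl, ← hww t ⟨by linarith, le_rfl⟩,
      evalP_sub _ _ ⟨by linarith, by linarith⟩, evalP_sub _ _ ⟨by linarith, by linarith⟩]
    have e2 := a4 t _ le_rfl hm hm'
    have e3 := b4 t _ le_rfl hm hm'
    have e4 : ∫ ξ in t..(min τ t'), cH ξ ≤ ∫ ξ in t..t', cH ξ := by
      have := intervalIntegral.integral_add_adjacent_intervals
        (ii_of_on hA4.1.1 (a := t) (b := min τ t') ⟨by linarith, by linarith⟩
          ⟨by linarith, by linarith⟩)
        (ii_of_on hA4.1.1 (a := min τ t') (b := t') ⟨by linarith, by linarith⟩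
          ⟨by linarith, by linarith⟩)
      have := hnn (min τ t') t' (by linarith) hm' htT
      linarith
    have e5 := mul_le_mul_of_nonneg_left e4 hK
    have e6 : evalP y₁' (min τ t') - evalP y₂' (min τ t') - (evalP y₁' t - evalP y₂' t) =
      (evalP y₁' (min τ t') - evalP y₁' t) - (evalP y₂' (min τ t') - evalP y₂' t) := by abel
    rw [e6]
    have := norm_sub_le (evalP y₁' (min τ t') - evalP y₁' t) (evalP y₂' (min τ t') - evalP y₂' t)
    linarith
  have hM : ‖y₁ - y₂‖ ≤ ‖y₁' - y₂'‖ := by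
    apply path_norm_le _ (norm_nonneg _)
    intro τ hτ
    rcases le_total τ t with h1 | h1
    · rw [← hww τ ⟨hτ.1, h1⟩]; exact norm_evalP_le _ _
    · rw [hwT τ h1 hτ.2, ← hww t ⟨by linarith, le_rfl⟩]; exact norm_evalP_le _ _
  refine ⟨y₁', hD₁, y₂', hD₂, hs₁', hs₂', a2, b2, hM, hinc T (by linarith) le_rfl, ?_, ?_⟩
  · rcases le_or_gt ‖y₁' - y₂'‖ ‖y₁ - y₂‖ with h1 | h1
    · exact Or.inl (le_antisymm h1 hM)
    · right
      have : ‖y₁' - y₂'‖ ≤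
          max ‖y₁ - y₂‖ (‖evalP (y₁ - y₂) T‖ + 2 * K * ∫ ξ in t..t', cH ξ) := by
        apply path_norm_le _ ((norm_nonneg _).trans (le_max_left _ _))
        intro τ hτ
        rcases le_total τ t with h2 | h2
        · rw [hww τ ⟨hτ.1, h2⟩]; exact (norm_evalP_le _ _).trans (le_max_left _ _)
        · refine le_trans ?_ (le_max_right _ _)
          have := hinc τ h2 hτ.2
          have := norm_sub_norm_le (evalP (y₁' - y₂') τ) (evalP (y₁ - y₂) T)
          linarith
      rcases le_max_iff.1 this with h3 | h3
      · linarith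
      · exact h3
  · rw [evalP_sub _ _ mT, evalP_sub _ _ mT]
    simp only [inner_sub_right] at hpφ hqφ ⊢
    linarith

lemma Q_step {F : Type*} [NormedAddCommGroup F] [InnerProductSpace ℝ F] (a b : F)
    {M M' r R L δ g β β₀ κ f f' B : ℝ}
    (haM : ‖a‖ ≤ M) (hMM : M ≤ M') (hbM : ‖b‖ ≤ M') (hab : ‖b - a‖ ≤ r) (hR : M' ≤ R)
    (hor : M' = M ∨ M' ≤ ‖a‖ + r) (hL : 0 ≤ L) (hLg : L ≤ g) (hrg : r ≤ g) (hgδ : g ≤ δ)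
    (hβ : 0 < β) (hβB : β ≤ B) (hβ₀ : β * (1 + 10 * L) ≤ β₀) (hκ : 0 < κ) (hκβ : 1 ≤ β * κ ^ 3)
    (hf : f' ≤ f + inner ℝ (-(β • ((4 * (2 * ‖a‖ ^ 2 - M ^ 2)) • a))) (b - a) +
      L * (1 + ‖-(β • ((4 * (2 * ‖a‖ ^ 2 - M ^ 2)) • a))‖) * M') :
    f' + β * ((M' ^ 2 - ‖b‖ ^ 2) ^ 2 + ‖b‖ ^ 4) ≤
      f + β₀ * ((M ^ 2 - ‖a‖ ^ 2) ^ 2 + ‖a‖ ^ 4) + κ * L +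
        (1 + B * (4 * R ^ 3 + 26 * R ^ 2)) * δ * g := by
  have hV := V_step a b haM hMM hbM hab hR hor
  rw [inner_neg_left, real_inner_smul_left] at hf
  set i := inner ℝ ((4 * (2 * ‖a‖ ^ 2 - M ^ 2)) • a) (b - a)
  have ha0 := norm_nonneg a
  have hr0 : 0 ≤ r := (norm_nonneg _).trans hab
  have hM0 : 0 ≤ M := ha0.trans haM
  have hR0 : 0 ≤ R := by linarith
  have hM' : M' ≤ M + r := by rcases hor with h | h <;> linarith
  have hs : ‖-(β • ((4 * (2 * ‖a‖ ^ 2 - M ^ 2)) • a))‖ ≤ 4 * β * M ^ 3 := by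
    rw [norm_neg, norm_smul, norm_smul, Real.norm_eq_abs, Real.norm_eq_abs, abs_of_pos hβ, abs_mul]
    have h1 : |2 * ‖a‖ ^ 2 - M ^ 2| ≤ M ^ 2 := by
      rw [abs_le]
      have : ‖a‖ ^ 2 ≤ M ^ 2 := by gcongr
      constructor <;> nlinarith [sq_nonneg ‖a‖]
    have h2 : |2 * ‖a‖ ^ 2 - M ^ 2| * ‖a‖ ≤ M ^ 2 * M := mul_le_mul h1 haM ha0 (by positivity)
    rw [abs_of_pos (by norm_num : (0:ℝ) < 4)]
    calc _ = 4 * β * (|2 * ‖a‖ ^ 2 - M ^ 2| * ‖a‖) := by ring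
      _ ≤ 4 * β * (M ^ 2 * M) := by gcongr
      _ = _ := by ring
  set S := ‖-(β • ((4 * (2 * ‖a‖ ^ 2 - M ^ 2)) • a))‖
  have hS0 : 0 ≤ S := norm_nonneg _
  set V := (M ^ 2 - ‖a‖ ^ 2) ^ 2 + ‖a‖ ^ 4 with hVdef
  have hV1 : M ^ 4 ≤ 2 * V := by
    rw [hVdef]; nlinarith [sq_nonneg (M ^ 2 - 2 * ‖a‖ ^ 2)]
  have hV0 : 0 ≤ V := by positivity
  have hMκ : M ≤ κ + β * M ^ 4 := by
    rcases le_total M κ with h | h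
    · have : 0 ≤ β * M ^ 4 := by positivity
      linarith
    · have h1 : κ ^ 3 ≤ M ^ 3 := by gcongr
      have h2 : 1 ≤ β * M ^ 3 := hκβ.trans (by gcongr)
      nlinarith
  have hM'0 : 0 ≤ M' := by linarith
  clear_value V S i
  have e1 : L * (1 + S) * M' ≤ L * (1 + 4 * β * M ^ 3) * (M + r) := by gcongr
  have e2 : L * (1 + 4 * β * M ^ 3) * (M + r) =
      L * (M + 4 * (β * M ^ 4)) + L * r * (1 + 4 * β * M ^ 3) := by ring
  have hβM : β * M ^ 4 ≤ 2 * (β * V) := by nlinarith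
  have e3 : L * (M + 4 * (β * M ^ 4)) ≤ L * (κ + 10 * (β * V)) := by
    apply mul_le_mul_of_nonneg_left _ hL
    linarith
  have hB0 : 0 ≤ B := by linarith
  have hg0 : 0 ≤ g := by linarith
  have hδ0 : 0 ≤ δ := by linarith
  have hMR : M ≤ R := by linarith
  have e4 : L * r * (1 + 4 * β * M ^ 3) ≤ δ * g * (1 + 4 * B * R ^ 3) := by
    have : L * r ≤ δ * g := mul_le_mul (by linarith) hrg hr0 hδ0
    gcongr
  have e5 : β * (26 * R ^ 2 * r ^ 2) ≤ B * (26 * R ^ 2 * (δ * g)) := by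
    have : r ^ 2 ≤ δ * g := by
      rw [sq]; exact mul_le_mul (by linarith) hrg hr0 hδ0
    gcongr
  have e6 := mul_le_mul_of_nonneg_left hV hβ.le
  have e7 := mul_le_mul_of_nonneg_right hβ₀ hV0
  linarith

lemma exists_partition {a b : ℝ} (hab : a < b) {G : ℝ → ℝ} (hG : ContinuousOn G (Set.Icc a b))
    {δ : ℝ} (hδ : 0 < δ) : ∃ N : ℕ, 0 < N ∧ ∃ u : ℕ → ℝ, u 0 = a ∧ u N = b ∧
      (∀ i < N, u i < u (i + 1)) ∧ (∀ i ≤ N, u i ∈ Set.Icc a b) ∧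
      ∀ i < N, G (u (i + 1)) - G (u i) ≤ δ := by
  have huc := isCompact_Icc.uniformContinuousOn_of_continuous hG
  rw [Metric.uniformContinuousOn_iff] at huc
  obtain ⟨η, hη, hu⟩ := huc δ hδ
  obtain ⟨N, hN⟩ := exists_nat_gt ((b - a) / η)
  have hba : 0 < b - a := by linarith
  have hN0 : (0:ℝ) < N := lt_trans (div_pos hba hη) hN
  have hst : (b - a) / N < η := by
    rw [div_lt_iff₀ hN0]
    rw [div_lt_iff₀ hη] at hN
    linarith
  have hst0 : 0 < (b - a) / N := div_pos hba hN0
  have hmem : ∀ i : ℕ, i ≤ N → a + i * ((b - a) / N) ∈ Set.Icc a b := by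
    intro i hi
    have h1 : (i : ℝ) ≤ N := by exact_mod_cast hi
    refine ⟨by have : 0 ≤ (i : ℝ) * ((b - a) / N) := by positivity
               linarith, ?_⟩
    have : (i : ℝ) * ((b - a) / N) ≤ N * ((b - a) / N) := by gcongr
    rw [mul_div_cancel₀ _ hN0.ne'] at this
    linarith
  refine ⟨N, by exact_mod_cast hN0, fun i => a + i * ((b - a) / N), by simp, ?_, ?_, hmem, ?_⟩
  · simp only; rw [mul_div_cancel₀ _ hN0.ne']; ring
  · intro i hi
    push_cast
    linarith
  · intro i hi
    have := hu _ (hmem (i + 1) hi) _ (hmem i hi.le) (by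
      rw [Real.dist_eq]
      push_cast
      rw [show a + ((i : ℝ) + 1) * ((b - a) / N) - (a + i * ((b - a) / N)) = (b - a) / N by ring,
        abs_of_pos hst0]
      exact hst)
    rw [Real.dist_eq] at this
    exact (le_abs_self _).trans this.le

set_option maxHeartbeats 4000000 in
lemma comparison {n : ℕ} {h T : ℝ} (hT : 0 < T) (hh : 0 ≤ h)
    {H : ℝ → PathSp n h T → Euc n → ℝ} {cH : ℝ → ℝ} (hA : CondA H cH)
    {σ : PathSp n h T → ℝ} (hσ : Continuous σ) {φ₁ φ₂ : ℝ → PathSp n h T → ℝ}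
    (h₁ : UpperSol H cH σ φ₁) (h₂ : LowerSol H cH σ φ₂) :
    ∀ t ∈ Set.Icc (0:ℝ) T, ∀ x : PathSp n h T, φ₂ t x ≤ φ₁ t x := by
  intro t₀ ht₀ x₀
  obtain ⟨hn1, -, hσ1, hU⟩ := h₁
  obtain ⟨hn2, -, hσ2, hL⟩ := h₂
  rcases eq_or_lt_of_le ht₀.2 with hlt | hlt
  · subst hlt; exact (hσ2 x₀).trans (hσ1 x₀)
  by_contra hcon
  push Not at hcon
  obtain ⟨η, hη, hη3⟩ : ∃ η : ℝ, 0 < η ∧ φ₁ t₀ x₀ - φ₂ t₀ x₀ = -(3 * η) :=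
    ⟨(φ₂ t₀ x₀ - φ₁ t₀ x₀) / 3, by linarith, by ring⟩
  have hA' := hA
  obtain ⟨hA1, -, hA3, hA4, hA5⟩ := hA'
  have h0 := ht₀.1
  have hc := hA4.1
  set A : ℝ → ℝ := fun t => ∫ ξ in t₀..t, cH ξ with hAdef
  set K := (1 + ‖x₀‖) * Real.exp (2 * A T) with hKdef
  -- facts about primitives
  have prim : ∀ g : ℝ → ℝ, IntegNonneg T g →
      (∀ a b, t₀ ≤ a → a ≤ b → b ≤ T → ∫ ξ in a..b, g ξ =
        (∫ ξ in t₀..b, g ξ) - ∫ ξ in t₀..a, g ξ) ∧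
      (∀ a b, t₀ ≤ a → a ≤ b → b ≤ T → 0 ≤ ∫ ξ in a..b, g ξ) ∧
      ContinuousOn (fun t => ∫ ξ in t₀..t, g ξ) (Set.Icc t₀ T) := by
    intro g hg
    refine ⟨?_, ?_, ?_⟩
    · intro a b ha hab hb
      rw [intervalIntegral.integral_interval_sub_left]
      · exact ii_of_on hg.1 ⟨by linarith, by linarith⟩ ⟨by linarith, by linarith⟩
      · exact ii_of_on hg.1 ⟨by linarith, by linarith⟩ ⟨by linarith, by linarith⟩
    · intro a b ha hab hb
      exact intervalIntegral.integral_nonneg hab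
        (fun u hu => hg.2 u ⟨by linarith [hu.1], by linarith [hu.2]⟩)
    · have := intervalIntegral.continuousOn_primitive_interval' (μ := volume) (f := g)
        (a := t₀) (b₁ := t₀) (b₂ := T)
        (ii_of_on hg.1 ⟨by linarith, by linarith⟩ ⟨by linarith, by linarith⟩) Set.left_mem_uIcc
      rwa [Set.uIcc_of_le hlt.le] at this
  obtain ⟨cA, cB, cC⟩ := prim cH hc
  have hAT : 0 ≤ A T := cB t₀ T le_rfl hlt.le le_rfl
  have hx0 := norm_nonneg x₀
  have hK1 : 1 ≤ K := by
    have : 1 ≤ Real.exp (2 * A T) := Real.one_le_exp (by linarith)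
    nlinarith
  have hK0 : 0 ≤ K := by linarith
  have hDc : IsCompact (DPath t₀ x₀ K cH) := DPath_compact hh hT ht₀ x₀ K hc
  obtain ⟨lam, hlam⟩ := hA3 _ hDc
  obtain ⟨lA, lB, lC⟩ := prim lam hlam.1
  set Λ : ℝ → ℝ := fun t => ∫ ξ in t₀..t, lam ξ with hΛdef
  have hΛT : 0 ≤ Λ T := lB t₀ T le_rfl hlt.le le_rfl
  -- `σ` on the compact set
  obtain ⟨B₀, hB₀⟩ : ∃ B₀, ∀ y ∈ DPath t₀ x₀ K cH, |σ y| ≤ B₀ := by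
    obtain ⟨B₀, hB₀⟩ := hDc.exists_bound_of_continuousOn hσ.continuousOn
    exact ⟨B₀, fun y hy => hB₀ y hy⟩
  have hB₀0 : 0 ≤ B₀ := (abs_nonneg _).trans (hB₀ _ (DPath_start hh hT ht₀ x₀ hK0 cH))
  obtain ⟨ρ, hρ, hσρ⟩ : ∃ ρ > 0, ∀ y₁ ∈ DPath t₀ x₀ K cH, ∀ y₂ ∈ DPath t₀ x₀ K cH,
      ‖y₁ - y₂‖ < ρ → |σ y₁ - σ y₂| < η := by
    have := hDc.uniformContinuousOn_of_continuous hσ.continuousOn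
    rw [Metric.uniformContinuousOn_iff] at this
    obtain ⟨ρ, hρ, hu⟩ := this η hη
    exact ⟨ρ, hρ, fun y₁ m₁ y₂ m₂ hd => hu y₁ m₁ y₂ m₂ (by rwa [dist_eq_norm])⟩
  -- constants
  obtain ⟨κ, hκ, hκη⟩ : ∃ κ > 0, κ * Λ T ≤ η := by
    refine ⟨η / (Λ T + 1), by positivity, ?_⟩
    rw [div_mul_eq_mul_div, div_le_iff₀ (by linarith)]
    nlinarith
  set αT := Real.exp (-(10 * Λ T)) with hαT
  have hαT0 : 0 < αT := Real.exp_pos _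
  obtain ⟨B, hB0, hB1, hB2⟩ : ∃ B > 0, 1 ≤ B * αT * κ ^ 3 ∧ 2 * B₀ + 1 ≤ B * αT * (ρ ^ 4 / 2) := by
    refine ⟨1 / (αT * κ ^ 3) + (2 * B₀ + 1) / (αT * (ρ ^ 4 / 2)), by positivity, ?_, ?_⟩
    · have : 0 ≤ (2 * B₀ + 1) / (αT * (ρ ^ 4 / 2)) * (αT * κ ^ 3) := by positivity
      have h2 : 1 / (αT * κ ^ 3) * (αT * κ ^ 3) = 1 := by field_simp
      nlinarith
    · have : 0 ≤ 1 / (αT * κ ^ 3) * (αT * (ρ ^ 4 / 2)) := by positivity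
      have h2 : (2 * B₀ + 1) / (αT * (ρ ^ 4 / 2)) * (αT * (ρ ^ 4 / 2)) = 2 * B₀ + 1 := by
        field_simp
      nlinarith
  set R := 2 * K with hR
  set C := 1 + B * (4 * R ^ 3 + 26 * R ^ 2) with hC
  have hC0 : 0 < C := by positivity
  set G : ℝ → ℝ := fun t => 2 * K * A t + Λ t with hG
  have hGT : 0 ≤ G T := by simp only [hG]; positivity
  obtain ⟨δ, hδ, hδ1, hδη⟩ : ∃ δ > 0, δ ≤ 1 ∧ C * δ * G T < η := by
    have hp : 0 < C * G T + 1 := by positivity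
    refine ⟨min 1 (η / (2 * (C * G T + 1))), by positivity, min_le_left _ _, ?_⟩
    have h1 : C * min 1 (η / (2 * (C * G T + 1))) * G T ≤ (C * G T) * (η / (2 * (C * G T + 1))) := by
      calc _ = (C * G T) * min 1 (η / (2 * (C * G T + 1))) := by ring
        _ ≤ _ := mul_le_mul_of_nonneg_left (min_le_right _ _) (by positivity)
    refine h1.trans_lt ?_
    rw [← mul_div_assoc, div_lt_iff₀ (by positivity)]
    have : 0 ≤ C * G T * η := by positivity
    nlinarith
  have hGc : ContinuousOn G (Set.Icc t₀ T) := (continuousOn_const.mul cC).add lC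
  obtain ⟨N, hN, u, hu0, huN, humono, humem, huG⟩ := exists_partition hlt hGc hδ
  -- the induction
  have ind : ∀ i ≤ N, ∃ y₁ ∈ DPath t₀ x₀ K cH, ∃ y₂ ∈ DPath t₀ x₀ K cH,
      stopPath (u i) y₁ = y₁ ∧ stopPath (u i) y₂ = y₂ ∧
      1 + ‖y₁‖ ≤ (1 + ‖x₀‖) * Real.exp (2 * A (u i)) ∧
      1 + ‖y₂‖ ≤ (1 + ‖x₀‖) * Real.exp (2 * A (u i)) ∧
      φ₁ (u i) y₁ - φ₂ (u i) y₂ + (B * Real.exp (-(10 * Λ (u i)))) *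
        ((‖y₁ - y₂‖ ^ 2 - ‖evalP (y₁ - y₂) T‖ ^ 2) ^ 2 + ‖evalP (y₁ - y₂) T‖ ^ 4) ≤
        -(3 * η) + κ * Λ (u i) + C * δ * G (u i) := by
    intro i
    induction i with
    | zero =>
      intro _
      have hst := DPath_start hh hT ht₀ x₀ hK0 cH
      have hn : 1 + ‖stopPath t₀ x₀‖ ≤ (1 + ‖x₀‖) * Real.exp (2 * A t₀) := by
        have : A t₀ = 0 := intervalIntegral.integral_same
        rw [this]
        simpa using norm_stop_le x₀ t₀
      rw [hu0]
      refine ⟨_, hst, _, hst, stop_stop _ le_rfl, stop_stop _ le_rfl, hn, hn, ?_⟩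
      have e1 : A t₀ = 0 := intervalIntegral.integral_same
      have e2 : Λ t₀ = 0 := intervalIntegral.integral_same
      have e3 : evalP (0 : PathSp n h T) T = 0 := by
        rw [evalP_eq _ ⟨by linarith, le_rfl⟩]; rfl
      rw [← hn1 t₀ ht₀, ← hn2 t₀ ht₀, hη3]
      simp [hG, e1, e2, e3]
    | succ i ih =>
      intro hi
      have hiN : i < N := hi
      obtain ⟨y₁, hy₁, y₂, hy₂, hs₁, hs₂, hk₁, hk₂, hQ⟩ := ih hiN.le
      have hlt' := humono i hiN
      have m1 := humem i hiN.le
      have m2 := humem (i + 1) hi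
      have hgd := huG i hiN
      have eA := cA (u i) (u (i + 1)) m1.1 hlt'.le m2.2
      have eΛ := lA (u i) (u (i + 1)) m1.1 hlt'.le m2.2
      have nA := cB (u i) (u (i + 1)) m1.1 hlt'.le m2.2
      have nΛ := lB (u i) (u (i + 1)) m1.1 hlt'.le m2.2
      have eA' : A (u (i + 1)) = A (u i) + ∫ ξ in (u i)..(u (i + 1)), cH ξ := by
        simp only [hAdef]; linarith
      have eΛ' : Λ (u (i + 1)) = Λ (u i) + ∫ ξ in (u i)..(u (i + 1)), lam ξ := by
        simp only [hΛdef]; linarith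
      have nAT : A (u (i + 1)) ≤ A T := by
        have e1 := cA (u (i + 1)) T m2.1 m2.2 le_rfl
        have e2 := cB (u (i + 1)) T m2.1 m2.2 le_rfl
        simp only [hAdef]; linarith
      have nΛT : Λ (u (i + 1)) ≤ Λ T := by
        have e1 := lA (u (i + 1)) T m2.1 m2.2 le_rfl
        have e2 := lB (u (i + 1)) T m2.1 m2.2 le_rfl
        simp only [hΛdef]; linarith
      have nΛ0 : 0 ≤ Λ (u (i + 1)) := lB t₀ (u (i + 1)) le_rfl m2.1 m2.2
      have eG : G (u (i + 1)) = G (u i) + (2 * K * (∫ ξ in (u i)..(u (i + 1)), cH ξ) +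
          ∫ ξ in (u i)..(u (i + 1)), lam ξ) := by
        simp only [hG]; rw [eA', eΛ']; ring
      generalize hΔ : (∫ ξ in (u i)..(u (i + 1)), cH ξ) = Δ at *
      generalize hL' : (∫ ξ in (u i)..(u (i + 1)), lam ξ) = L at *
      have hKΔ : 0 ≤ 2 * K * Δ := by positivity
      have hgδ : 2 * K * Δ + L ≤ δ := by linarith
      have hΔ2 : Δ ≤ 1 / 2 := by nlinarith
      have hkk : ∀ y : PathSp n h T, 1 + ‖y‖ ≤ (1 + ‖x₀‖) * Real.exp (2 * A (u i)) →
          (1 + ‖y‖) * Real.exp (2 * Δ) ≤ (1 + ‖x₀‖) * Real.exp (2 * A (u (i + 1))) := by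
        intro y hy
        rw [eA', mul_add, Real.exp_add, ← mul_assoc]
        exact mul_le_mul_of_nonneg_right hy (Real.exp_pos _).le
      have hKK : (1 + ‖x₀‖) * Real.exp (2 * A (u (i + 1))) ≤ K := by
        rw [hKdef]; gcongr
      set β := B * Real.exp (-(10 * Λ (u (i + 1)))) with hβdef
      have hβ0 : 0 < β := by positivity
      set s : Euc n := -(β • ((4 * (2 * ‖evalP (y₁ - y₂) T‖ ^ 2 - ‖y₁ - y₂‖ ^ 2)) •
        evalP (y₁ - y₂) T)) with hs
      obtain ⟨y₁', hy₁', y₂', hy₂', hs₁', hs₂', hk₁', hk₂', hMM, hab, hor, hφ⟩ :=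
        step_main hh hA hn1 hn2 hU hL ht₀ x₀ hK0 hlam m1.1 hlt' m2.2 (by rw [hΔ]; exact hΔ2)
          hy₁ hy₂ hs₁ hs₂ (by rw [hΔ]; exact (hkk y₁ hk₁).trans hKK)
          (by rw [hΔ]; exact (hkk y₂ hk₂).trans hKK) s
      rw [hΔ] at hk₁' hk₂' hab hor
      rw [hL'] at hφ
      have hj₁ := hk₁'.trans (hkk y₁ hk₁)
      have hj₂ := hk₂'.trans (hkk y₂ hk₂)
      refine ⟨y₁', hy₁', y₂', hy₂', hs₁', hs₂', hj₁, hj₂, ?_⟩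
      have hM'R : ‖y₁' - y₂'‖ ≤ R := by
        have := norm_sub_le y₁' y₂'
        linarith
      have hβB : β ≤ B := by
        rw [hβdef]
        exact mul_le_of_le_one_right hB0.le (Real.exp_le_one_iff.2 (by linarith))
      have hβ₀ : β * (1 + 10 * L) ≤ B * Real.exp (-(10 * Λ (u i))) := by
        have e1 : -(10 * Λ (u i)) = -(10 * Λ (u (i + 1))) + 10 * L := by rw [eΛ']; ring
        rw [e1, Real.exp_add, ← mul_assoc]
        apply mul_le_mul_of_nonneg_left _ hβ0.le
        have := Real.add_one_le_exp (10 * L); linarith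
      have hκβ : 1 ≤ β * κ ^ 3 := by
        refine hB1.trans ?_
        have : αT ≤ Real.exp (-(10 * Λ (u (i + 1)))) := Real.exp_le_exp.2 (by linarith)
        rw [hβdef]; gcongr
      have hfin := Q_step (evalP (y₁ - y₂) T) (evalP (y₁' - y₂') T) (norm_evalP_le _ _) hMM
        (norm_evalP_le _ _) hab hM'R hor nΛ (by linarith : L ≤ 2 * K * Δ + L) (by linarith) hgδ
        hβ0 hβB hβ₀ hκ hκβ hφ
      rw [← hC] at hfin
      rw [eΛ', eG]
      linarith
  obtain ⟨y₁, hy₁, y₂, hy₂, -, -, -, -, hQ⟩ := ind N le_rfl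
  rw [huN] at hQ
  have s1 := hσ1 y₁
  have s2 := hσ2 y₂
  have b1 := abs_le.1 (hB₀ y₁ hy₁)
  have b2 := abs_le.1 (hB₀ y₂ hy₂)
  set m := ‖y₁ - y₂‖ with hm
  set q := ‖evalP (y₁ - y₂) T‖
  have hV : m ^ 4 / 2 ≤ (m ^ 2 - q ^ 2) ^ 2 + q ^ 4 := by
    nlinarith [sq_nonneg (m ^ 2 - 2 * q ^ 2)]
  have hβ : 0 < B * αT := by positivity
  have hm0 : 0 ≤ m := norm_nonneg _
  rcases lt_or_ge m ρ with hc1 | hc1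
  · have := abs_lt.1 (hσρ y₁ hy₁ y₂ hy₂ hc1)
    have hV0 : 0 ≤ B * αT * ((m ^ 2 - q ^ 2) ^ 2 + q ^ 4) := by positivity
    linarith
  · have e1 : ρ ^ 4 / 2 ≤ m ^ 4 / 2 := by gcongr
    have e2 := mul_le_mul_of_nonneg_left (e1.trans hV) hβ.le
    linarith

/-- uniqueness: under Assumption 1 there exists at most one
minimax solution of the Cauchy problem: any two coincide on `[0,T] × C`. -/
theorem stmt13 {n : ℕ} {h T : ℝ} (hT : 0 < T) (hh : 0 ≤ h)
    (H : ℝ → PathSp n h T → Euc n → ℝ) (cH : ℝ → ℝ) (hH : CondA H cH)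
    (σ : PathSp n h T → ℝ) (hσ : Continuous σ)
    (φ₁ φ₂ : ℝ → PathSp n h T → ℝ)
    (h₁ : MinimaxSol H cH σ φ₁) (h₂ : MinimaxSol H cH σ φ₂) :
    ∀ t ∈ Set.Icc (0:ℝ) T, ∀ x : PathSp n h T, φ₁ t x = φ₂ t x := by
  intro t ht x
  exact le_antisymm (comparison hT hh hH hσ h₂.1 h₁.2 t ht x)
    (comparison hT hh hH hσ h₁.1 h₂.2 t ht x)

end
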